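/- arXiv:2205.04184 — 2 statements merged into one kernel-verified Lean document; each statement's English description precedes it below -/
import Mathlib

section
/- Let n ≥ 2 and s ≥ n+3, let m ≥ 1 be an integer and suppose m_1 = ⋯ = m_s = m, the system L = L_{n,d}(m,…,m) is nonzero (effective), and k_C = m. Then dim L = Σ (−1)^{|I|} · F_t(n + k_{I,t} − r_{I,t} − 1, s, ε, n), where ε is the exceeding number and the sum ranges over all integers t with 0 ≤ 2t ≤ n and all subsets I ⊆ {1,…,s} with |I| ≤ n − 2t. -/
open Finset

noncomputable section

/-- Binomial coefficient `C(a,k)` with integer arguments; zero if `k < 0` or `a < k`. -/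
def Cb (a k : ℤ) : ℤ := if 0 ≤ k ∧ k ≤ a then (Nat.choose a.toNat k.toNat : ℤ) else 0

/-- The recursively defined function `F_t(a, s, ε, n)`. -/
def Fb : ℕ → ℤ → ℕ → ℕ → ℤ → ℤ
  | 0, a, _, _, n => Cb a n
  | (t+1), a, s, e, n =>
      if n < 0 then 0 else
      Cb a n
        + ∑ j ∈ Finset.range (t+1), Cb ((s : ℤ) - n - 4 + (j+1)) (j+1) * Cb (a + (j+1)) n
        - ∑ j ∈ Finset.range (t+1), Cb (e : ℤ) (j+1) * Fb (t - j) a s e (n - (j+1))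
  termination_by t _ _ _ _ => t
  decreasing_by omega

/-- Iterated partial derivative along a list of coordinate directions, as a linear map. -/
def derivAlong {n : ℕ} (D : List (Fin (n+1))) :
    MvPolynomial (Fin (n+1)) ℂ →ₗ[ℂ] MvPolynomial (Fin (n+1)) ℂ :=
  D.foldr (fun j f => (MvPolynomial.pderiv j).toLinearMap.comp f) LinearMap.id

/-- The point `(1, u, u², …, uⁿ) ∈ ℂ^{n+1}` on the affine cone over the
rational normal curve of degree `n`. -/
def rncPoint (n : ℕ) (u : ℂ) : Fin (n+1) → ℂ := fun j => u ^ (j : ℕ)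

/-- The linear system `L_{n,d}(m_1,…,m_s)`: homogeneous polynomials of degree `d`
in `x_0,…,x_n` all of whose partial derivatives of total order `≤ m_i − 1`
vanish at the point `p_i = (1, t_i, …, t_iⁿ)`. -/
def linSys (n d s : ℕ) (m : Fin s → ℕ) (tp : Fin s → ℂ) :
    Submodule ℂ (MvPolynomial (Fin (n+1)) ℂ) :=
  MvPolynomial.homogeneousSubmodule (Fin (n+1)) ℂ d ⊓
    ⨅ (i : Fin s), ⨅ (D : List (Fin (n+1))), ⨅ (_ : D.length < m i),
      LinearMap.ker
        ((MvPolynomial.aeval (rncPoint n (tp i))).toLinearMap.comp (derivAlong D))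

/-- `k_C = ⌈(m_1+⋯+m_s − nd)/(s−n−2)⌉`. -/
def kC (n d s : ℕ) (m : Fin s → ℕ) : ℤ :=
  ⌈((∑ i, (m i : ℚ)) - (n : ℚ) * d) / ((s : ℚ) - n - 2)⌉



/-- number of sequences, first entry `< c`, adjacent sums `≤ k`, total `d` -/
def Acnt (k : ℕ) : ℕ → ℕ → ℕ → ℕ
  | 0, d, c => if d < c then 1 else 0
  | (n+1), d, c => ∑ b ∈ Finset.range c, if b ≤ d then Acnt k n (d-b) (k+1-b) else 0

theorem Acnt_bound (k n : ℕ) : ∀ d c, c ≤ k + 1 → Acnt k n d c ≠ 0 →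
    (∀ p, n = 2 * p → d + 1 ≤ p * k + c) ∧ (∀ p, n = 2 * p + 1 → d ≤ (p + 1) * k) := by
  induction n with
  | zero =>
    intro d c hc h
    simp only [Acnt] at h
    have : d < c := by by_contra h'; simp [h'] at h
    refine ⟨fun p hp => ?_, fun p hp => by omega⟩
    have : p = 0 := by omega
    subst this
    omega
  | succ n ih =>
    intro d c hc h
    simp only [Acnt] at h
    obtain ⟨b, hb, hb'⟩ := Finset.exists_ne_zero_of_sum_ne_zero h
    rw [Finset.mem_range] at hb
    have hbd : b ≤ d := by by_contra h'; simp [h'] at hb'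
    rw [if_pos hbd] at hb'
    obtain ⟨h1, h2⟩ := ih _ _ (by omega) hb'
    refine ⟨fun p hp => ?_, fun p hp => ?_⟩
    · obtain ⟨p, rfl⟩ : ∃ p', p = p' + 1 := ⟨p - 1, by omega⟩
      have := h2 p (by omega)
      omega
    · have := h1 p (by omega)
      have e : (p+1)*k = p*k+k := by ring
      omega

theorem Acnt_zero (k n d c : ℕ) (hc : c ≤ k + 1) (h : (n+1)*k + c ≤ 2 * d) : Acnt k n d c = 0 := by
  by_contra hne
  obtain ⟨h1, h2⟩ := Acnt_bound k n d c hc hne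
  rcases Nat.even_or_odd' n with ⟨p, hp | hp⟩
  · have := h1 p hp
    subst hp
    have e : (2*p+1)*k = 2 * (p*k)+k := by ring
    omega
  · have := h2 p hp
    have h0 : c = 0 := by
      subst hp
      have e : (2*p+1+1)*k = 2 * ((p+1)*k) := by ring
      omega
    subst h0
    subst hp
    simp [Acnt] at hne

open PowerSeries in
theorem geom_pow_symm (k N : ℕ) (i j : ℕ) (h : i + j = N * k) :
    (Polynomial.coeff ((∑ l ∈ Finset.range (k+1), (Polynomial.X : Polynomial ℤ)^l)^N) i)
     = (Polynomial.coeff ((∑ l ∈ Finset.range (k+1), (Polynomial.X : Polynomial ℤ)^l)^N) j) := by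
  set T : Polynomial ℤ := ∑ l ∈ Finset.range (k+1), (Polynomial.X : Polynomial ℤ)^l with hT
  have hdeg : T.natDegree ≤ k := by
    apply Polynomial.natDegree_sum_le_of_forall_le
    intro l hl
    rw [Polynomial.natDegree_X_pow]
    simp at hl; omega
  have hc : ∀ j, T.coeff j = if j ≤ k then 1 else 0 := by
    intro j
    simp [hT, Polynomial.coeff_X_pow]
  have hr : Polynomial.reflect k T = T := by
    ext j
    rw [Polynomial.coeff_reflect, hc, hc]
    by_cases hj : j ≤ k
    · rw [Polynomial.revAt_le hj]; simp [hj]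
    · rw [Polynomial.revAt_eq_self_of_lt (by omega)]
  have hN : ∀ N, (T^N).natDegree ≤ N * k ∧ Polynomial.reflect (N*k) (T^N) = T^N := by
    intro N
    induction N with
    | zero => simp
    | succ N ih =>
      constructor
      · exact Polynomial.natDegree_pow_le.trans (Nat.mul_le_mul_left _ hdeg)
      · rw [pow_succ, Nat.succ_mul, Polynomial.reflect_mul _ _ ih.1 hdeg, ih.2, hr]
  rw [← (hN N).2, Polynomial.coeff_reflect, Polynomial.revAt_le (by omega), (hN N).2]
  congr 1
  omega

theorem geom_pow_big (k N i : ℕ) (h : N * k < i) :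
    (Polynomial.coeff ((∑ l ∈ Finset.range (k+1), (Polynomial.X : Polynomial ℤ)^l)^N) i) = 0 := by
  apply Polynomial.coeff_eq_zero_of_natDegree_lt
  refine lt_of_le_of_lt Polynomial.natDegree_pow_le (lt_of_le_of_lt (Nat.mul_le_mul_left _ ?_) h)
  apply Polynomial.natDegree_sum_le_of_forall_le
  intro l hl
  rw [Polynomial.natDegree_X_pow]
  simp at hl; omega

theorem middle_zero (k N d c : ℕ) (h : 2 * d = N * k + c) :
    PowerSeries.coeff d ((1 - (PowerSeries.X : PowerSeries ℤ)^c) *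
      (∑ l ∈ Finset.range (k+1), (PowerSeries.X : PowerSeries ℤ)^l)^N) = 0 := by
  have e : (∑ l ∈ Finset.range (k+1), (PowerSeries.X : PowerSeries ℤ)^l)^N =
     (((∑ l ∈ Finset.range (k+1), (Polynomial.X : Polynomial ℤ)^l)^N : Polynomial ℤ) : PowerSeries ℤ) := by
    rw [Polynomial.coe_pow]
    congr 1
    ext j
    simp [Polynomial.coeff_X_pow, PowerSeries.coeff_X_pow]
  rw [e, sub_mul, one_mul, map_sub, PowerSeries.coeff_X_pow_mul']
  split_ifs with hcd
  · rw [Polynomial.coeff_coe, Polynomial.coeff_coe, geom_pow_symm k N d (d-c) (by omega), sub_self]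
  · rw [Polynomial.coeff_coe, geom_pow_big _ _ _ (by omega), sub_zero]

theorem Acnt_formula (k : ℕ) (vx vq : PowerSeries ℤ)
    (hvx : (1 - PowerSeries.X) * vx = 1) (hvq : (1 - PowerSeries.X ^ (k+2)) * vq = 1) (n : ℕ) :
    ∀ d c r : ℕ, c ≤ k + 1 → 2 * d + r = (n+1) * k + c →
    (Acnt k n d c : ℤ) = PowerSeries.coeff d
      ((1 - PowerSeries.X ^ c) * (1 - PowerSeries.X ^ (k+1))^(n+1+r) * vx^(n+1) * vq^r) := by
  have hgeom : (1 - (PowerSeries.X : PowerSeries ℤ) ^ (k+1)) * vx =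
      ∑ l ∈ Finset.range (k+1), (PowerSeries.X : PowerSeries ℤ)^l := by
    have := mul_neg_geom_sum (PowerSeries.X : PowerSeries ℤ) (k+1)
    rw [← this, mul_right_comm, hvx, one_mul]
  induction n with
  | zero =>
    intro d c r hc h
    have hd : d ≤ k := by omega
    have h1 : (PowerSeries.X : PowerSeries ℤ)^(k+1) ∣ (1 - PowerSeries.X ^ (k+1))^(0+1+r) * vq^r - 1 := by
      have a1 : (PowerSeries.X : PowerSeries ℤ)^(k+1) ∣ (1 - PowerSeries.X ^ (k+1))^(0+1+r) - 1 := by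
        have := sub_dvd_pow_sub_pow (1 - (PowerSeries.X : PowerSeries ℤ) ^ (k+1)) 1 (0+1+r)
        rw [one_pow] at this
        refine dvd_trans ⟨-1, by ring⟩ this
      have a2 : (PowerSeries.X : PowerSeries ℤ)^(k+1) ∣ vq^r - 1 := by
        have := sub_dvd_pow_sub_pow vq 1 r
        rw [one_pow] at this
        refine dvd_trans ⟨PowerSeries.X * vq, ?_⟩ this
        linear_combination hvq
      have : (1 - (PowerSeries.X : PowerSeries ℤ) ^ (k+1))^(0+1+r) * vq^r - 1
        = ((1 - (PowerSeries.X : PowerSeries ℤ) ^ (k+1))^(0+1+r) - 1) * vq^r + (vq^r - 1) := by ring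
      rw [this]
      exact dvd_add (dvd_mul_of_dvd_left a1 _) a2
    obtain ⟨w, hw⟩ := h1
    have e2 : (1 - (PowerSeries.X : PowerSeries ℤ) ^ c) * (1 - PowerSeries.X ^ (k+1))^(0+1+r) * vx^(0+1) * vq^r
      = (∑ l ∈ Finset.range c, (PowerSeries.X : PowerSeries ℤ)^l) +
         PowerSeries.X^(k+1) * (w * ((1 - PowerSeries.X ^ c) * vx)) := by
      have := mul_neg_geom_sum (PowerSeries.X : PowerSeries ℤ) c
      rw [← this]
      linear_combination ((1 - PowerSeries.X) * (∑ l ∈ Finset.range c, (PowerSeries.X : PowerSeries ℤ)^l) * vx) * hw + (∑ l ∈ Finset.range c, (PowerSeries.X : PowerSeries ℤ)^l) * hvx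
    rw [e2, map_add, PowerSeries.coeff_X_pow_mul', if_neg (by omega), add_zero, map_sum]
    simp [Acnt, PowerSeries.coeff_X_pow]
  | succ n ihn =>
    intro d c
    induction c with
    | zero =>
      intro r hc h
      simp [Acnt]
    | succ c ihc =>
      intro r hc h
      cases r with
      | zero =>
        rw [Acnt_zero _ _ _ _ hc (by omega)]
        rw [pow_zero, mul_one, add_zero, mul_assoc, ← mul_pow, hgeom, middle_zero]
        · rfl
        · simpa using h
      | succ r =>
        have s1 : (Acnt k (n+1) d (c+1) : ℤ) = Acnt k (n+1) d c +
            if c ≤ d then (Acnt k n (d-c) (k+1-c) : ℤ) else 0 := by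
          simp only [Acnt, Finset.sum_range_succ]
          push_cast
          rfl
        rw [s1, ihc r (by omega) (by omega)]
        have s2 : (if c ≤ d then (Acnt k n (d-c) (k+1-c) : ℤ) else 0) =
          PowerSeries.coeff d (PowerSeries.X^c * ((1 - PowerSeries.X ^ (k+1-c)) * (1 - PowerSeries.X ^ (k+1))^(n+1+(r+1)) * vx^(n+1) * vq^(r+1))) := by
          rw [PowerSeries.coeff_X_pow_mul']
          split_ifs with hcd
          · apply ihn
            · omega
            · have e : (n+1+1)*k = (n+1)*k+k := by ring
              omega
          · rfl
        rw [s2, ← map_add]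
        congr 1
        have hsplit : (PowerSeries.X : PowerSeries ℤ)^(k+1) = PowerSeries.X^c * PowerSeries.X^(k+1-c) := by
          rw [← pow_add]; congr 1; omega
        set q := (PowerSeries.X : PowerSeries ℤ)^(k+1) with hq
        have hq2 : (PowerSeries.X : PowerSeries ℤ)^(k+2) = q * PowerSeries.X := by rw [hq]; ring
        rw [hq2] at hvq
        have e3 : (1 - (PowerSeries.X : PowerSeries ℤ)^c) * (1-q)^(n+1+1+r) * vx^(n+1+1) * vq^r
          = (1 - (PowerSeries.X : PowerSeries ℤ)^c) * (1-q)^(n+1+1+r) * vx^(n+1+1) * vq^r * ((1 - q * PowerSeries.X) * vq) := by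
          rw [hvq, mul_one]
        have e4 : (PowerSeries.X : PowerSeries ℤ)^c * ((1 - PowerSeries.X ^ (k+1-c)) * (1 - q)^(n+1+(r+1)) * vx^(n+1) * vq^(r+1))
          = (PowerSeries.X^c - q) * (1 - q)^(n+1+(r+1)) * (vx^(n+1) * ((1 - PowerSeries.X) * vx)) * vq^(r+1) := by
          rw [hvx, hsplit]; ring
        rw [e3, e4]
        ring

/-- admissible exponent vectors -/
def Adm (k n d c : ℕ) : Finset (Fin (n+1) → ℕ) :=
  (Finset.Nat.antidiagonalTuple (n+1) d).filter
    (fun a => (∀ i : Fin n, a i.castSucc + a i.succ ≤ k) ∧ a 0 < c)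

theorem mem_Adm (k n d c : ℕ) (a : Fin (n+1) → ℕ) : a ∈ Adm k n d c ↔
    ∑ i, a i = d ∧ (∀ i : Fin n, a i.castSucc + a i.succ ≤ k) ∧ a 0 < c := by
  simp [Adm, Finset.Nat.mem_antidiagonalTuple]

theorem card_Adm (k n : ℕ) : ∀ d c, c ≤ k + 1 → (Adm k n d c).card = Acnt k n d c := by
  induction n with
  | zero =>
    intro d c hc
    simp only [Acnt]
    split_ifs with h
    · rw [Finset.card_eq_one]
      refine ⟨fun _ => d, ?_⟩
      ext a
      rw [mem_Adm, Finset.mem_singleton]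
      constructor
      · rintro ⟨h1, -, -⟩
        ext i
        have : i = 0 := Fin.ext (by have := i.isLt; simp only [Fin.val_zero]; omega)
        subst this
        simpa using h1
      · rintro rfl
        simpa using h
    · rw [Finset.card_eq_zero, Finset.eq_empty_iff_forall_notMem]
      intro a ha
      rw [mem_Adm] at ha
      obtain ⟨h1, -, h2⟩ := ha
      simp at h1
      omega
  | succ n ih =>
    intro d c hc
    simp only [Acnt]
    rw [Finset.card_eq_sum_card_fiberwise (f := fun a => a 0) (t := Finset.range c)]
    · apply Finset.sum_congr rfl
      intro b hb
      rw [Finset.mem_range] at hb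
      split_ifs with hbd
      · rw [← ih (d-b) (k+1-b) (by omega)]
        apply Finset.card_nbij' (fun a => Fin.tail a) (fun a => (Fin.cons b a : Fin (n+1+1) → ℕ))
        · intro a ha
          simp only [Finset.coe_filter, Set.mem_ofPred_eq, mem_Adm] at ha
          obtain ⟨⟨h1, h2, h3⟩, h4⟩ := ha
          simp only [Finset.mem_coe, mem_Adm]
          rw [Fin.sum_univ_succ] at h1
          refine ⟨?_, ?_, ?_⟩
          · simp only [Fin.tail]; omega
          · intro i
            have := h2 i.succ
            simpa [Fin.tail] using this
          · have := h2 0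
            simp only [Fin.tail]
            simp only [Fin.castSucc_zero] at this
            omega
        · intro a ha
          simp only [Finset.mem_coe, mem_Adm] at ha
          obtain ⟨h1, h2, h3⟩ := ha
          simp only [Finset.coe_filter, Set.mem_ofPred_eq, mem_Adm]
          refine ⟨⟨?_, ?_, ?_⟩, ?_⟩
          · rw [Fin.sum_univ_succ]; simp; omega
          · intro i
            refine Fin.cases ?_ (fun i => ?_) i
            · simp; omega
            · have := h2 i
              rw [Fin.castSucc_succ]
              simpa using this
          · simpa using hb
          · simp
        · intro a ha
          simp only [Finset.coe_filter, Set.mem_ofPred_eq] at ha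
          rw [← ha.2]
          exact Fin.cons_self_tail a
        · intro a ha
          simp
      · rw [Finset.card_eq_zero, Finset.eq_empty_iff_forall_notMem]
        intro a ha
        rw [Finset.mem_filter, mem_Adm] at ha
        obtain ⟨⟨h1, -⟩, h2⟩ := ha
        rw [Fin.sum_univ_succ] at h1
        omega
    · intro a ha
      simp only [Finset.mem_coe, mem_Adm] at ha
      simpa using ha.2.2

/-- coefficient at an integer position -/
def coeffZ (N : ℤ) : PowerSeries ℤ →+ ℤ :=
  if 0 ≤ N then (PowerSeries.coeff N.toNat).toAddMonoidHom else 0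

theorem coeffZ_nat (N : ℕ) (f : PowerSeries ℤ) : coeffZ N f = PowerSeries.coeff N f := by
  simp [coeffZ]

theorem coeffZ_neg {N : ℤ} (h : N < 0) (f : PowerSeries ℤ) : coeffZ N f = 0 := by
  simp [coeffZ, not_le.mpr h]

theorem coeffZ_X_pow_mul (N : ℤ) (r : ℕ) (f : PowerSeries ℤ) :
    coeffZ N (PowerSeries.X ^ r * f) = coeffZ (N - r) f := by
  rcases lt_or_ge N 0 with h | h
  · rw [coeffZ_neg h, coeffZ_neg (by omega)]
  · lift N to ℕ using h
    rw [coeffZ_nat, PowerSeries.coeff_X_pow_mul']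
    split_ifs with hr
    · rw [← coeffZ_nat]; congr 1; rw [Nat.cast_sub hr]
    · rw [coeffZ_neg (by omega)]

theorem mk_one_pow_coeff {R : Type*} [CommRing R] (D i : ℕ) :
    PowerSeries.coeff i ((PowerSeries.mk 1 : PowerSeries R)^(D+1)) = ((D+i).choose D : R) := by
  rw [PowerSeries.mk_one_pow_eq_mk_choose_add, PowerSeries.coeff_mk]

theorem Cb_coeffZ (n : ℕ) (N : ℤ) :
    Cb (n + N) n = coeffZ N ((PowerSeries.mk 1 : PowerSeries ℤ)^(n+1)) := by
  rcases lt_or_ge N 0 with h | h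
  · rw [coeffZ_neg h, Cb, if_neg (by omega)]
  · lift N to ℕ using h
    rw [coeffZ_nat, mk_one_pow_coeff, Cb, if_pos (by omega)]
    norm_cast

theorem Cb_coeff_pos {R : Type*} [CommRing R] (D i : ℕ) :
    PowerSeries.coeff (i+1) ((PowerSeries.mk 1 : PowerSeries R)^D) = ((Cb ((D:ℤ) - 1 + (i+1)) (i+1) : ℤ) : R) := by
  cases D with
  | zero =>
    rw [Cb, if_neg (by push_cast; omega)]
    simp [PowerSeries.coeff_one]
  | succ D =>
    rw [mk_one_pow_coeff, Cb, if_pos (by push_cast; omega)]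
    have e1 : (((D+1 : ℕ):ℤ) - 1 + (i+1)).toNat = D + (i+1) := by push_cast; omega
    have e2 : ((i:ℤ)+1).toNat = i+1 := by omega
    rw [e1, e2, Int.cast_natCast]
    rw [Nat.choose_symm_add]

theorem Cb_nat (a b : ℕ) : Cb (a:ℤ) (b:ℤ) = (a.choose b : ℤ) := by
  rw [Cb]
  split_ifs with h
  · simp
  · rw [Nat.choose_eq_zero_of_lt (by omega)]; rfl

abbrev BB := PowerSeries (PowerSeries ℤ)
/-- inverse of `1 - z` -/
def vzB : BB := PowerSeries.mk 1
/-- inverse of `1 - z x` -/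
def vzxB : BB := PowerSeries.mk (fun j => PowerSeries.X ^ j)
/-- inverse of `1 - x` -/
def vxA : PowerSeries ℤ := PowerSeries.mk 1

theorem vzB_mul : (1 - PowerSeries.X) * vzB = 1 := by
  rw [mul_comm]; exact PowerSeries.mk_one_mul_one_sub_eq_one _
theorem vxA_mul : (1 - PowerSeries.X) * vxA = 1 := by
  rw [mul_comm]; exact PowerSeries.mk_one_mul_one_sub_eq_one _
theorem vzxB_mul : (1 - PowerSeries.C (PowerSeries.X : PowerSeries ℤ) * PowerSeries.X) * vzxB = 1 := by
  refine PowerSeries.ext fun j => ?_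
  rw [sub_mul, one_mul, map_sub, mul_assoc, PowerSeries.coeff_C_mul]
  cases j with
  | zero => simp [vzxB]
  | succ j => 
    rw [PowerSeries.coeff_succ_X_mul]
    simp [vzxB, PowerSeries.coeff_one, pow_succ']

def HB (s e n : ℕ) : BB := vzB ^ (s - n - 3 - e) * vzxB ^ (1 + e) * PowerSeries.C (vxA ^ (n+1))

theorem HB_sum (s e n : ℕ) (h : n + 3 + e ≤ s) :
    ∑ i ∈ Finset.range (e+1), (e.choose i : BB) * ((PowerSeries.X * vzB * PowerSeries.C (1 - PowerSeries.X))^i * HB s e n)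
      = vzB ^ (s - n - 3) * (vzxB * PowerSeries.C (vxA^(n+1))) := by
  have h1 : ∑ i ∈ Finset.range (e+1), (e.choose i : BB) * ((PowerSeries.X * vzB * PowerSeries.C (1 - PowerSeries.X))^i * HB s e n)
     = ((PowerSeries.X * vzB * PowerSeries.C (1 - PowerSeries.X)) + 1)^e * HB s e n := by
    rw [add_pow, Finset.sum_mul]
    apply Finset.sum_congr rfl
    intro i _
    rw [one_pow]; ring
  have h2 : (PowerSeries.X * vzB * PowerSeries.C (1 - PowerSeries.X)) + 1 = vzB * (1 - PowerSeries.C (PowerSeries.X : PowerSeries ℤ) * PowerSeries.X) := by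
    rw [map_sub, map_one]
    linear_combination -vzB_mul
  have h3 : s - n - 3 = e + (s - n - 3 - e) := by omega
  rw [h1, h2, HB]
  rw [show vzB ^ (s - n - 3) = vzB ^ (e + (s - n - 3 - e)) by rw [← h3]]
  have h4 : (1 - PowerSeries.C (PowerSeries.X : PowerSeries ℤ) * PowerSeries.X)^e * vzxB^e = 1 := by
    rw [← mul_pow, vzxB_mul, one_pow]
  generalize PowerSeries.C (vxA^(n+1)) = cc
  rw [mul_pow, pow_add, pow_add, pow_one]
  linear_combination (vzB ^ e * vzB ^ (s - n - 3 - e) * (vzxB * cc)) * h4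

theorem HB_shift (s e n i : ℕ) (h : n + 3 + e ≤ s) (hi : i ≤ n) :
    (PowerSeries.X * vzB * PowerSeries.C (1 - PowerSeries.X))^i * HB s e n = PowerSeries.X ^ i * HB s e (n - i) := by
  rw [HB, HB]
  have h3 : s - (n-i) - 3 - e = i + (s - n - 3 - e) := by omega
  have h4 : n + 1 = i + (n - i + 1) := by omega
  rw [h3]
  rw [show vxA ^ (n+1) = vxA ^ (i + (n - i + 1)) by rw [← h4]]
  have h5 : (1 - PowerSeries.X : PowerSeries ℤ)^i * vxA^i = 1 := by
    rw [← mul_pow, vxA_mul, one_pow]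
  have h6 := congrArg (PowerSeries.C) h5
  rw [map_mul, map_one] at h6
  rw [mul_pow, mul_pow, pow_add vxA, map_mul, pow_add vzB, ← map_pow]
  linear_combination (PowerSeries.X ^ i * vzB ^ i * vzB ^ (s - n - 3 - e) * vzxB ^ (1+e) * PowerSeries.C (vxA ^(n-i+1))) * h6

theorem GB_coeff (D n t : ℕ) (N : ℤ) :
    coeffZ (N + (t+1)) (PowerSeries.coeff (t+1) (vzB ^ D * (vzxB * PowerSeries.C (vxA^(n+1)))))
     = Cb (n + N) n + ∑ j ∈ Finset.range (t+1), Cb ((D : ℤ) - 1 + (j+1)) (j+1) * Cb (n + N + (j+1)) n := by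
  rw [PowerSeries.coeff_mul, Finset.Nat.sum_antidiagonal_eq_sum_range_succ_mk, map_sum, Finset.sum_range_succ', add_comm]
  congr 1
  · simp only [vzB, vzxB]
    rw [PowerSeries.coeff_mul_C]
    simp only [PowerSeries.coeff_mk, PowerSeries.coeff_zero_eq_constantCoeff, map_pow]
    rw [show PowerSeries.constantCoeff (PowerSeries.mk 1 : BB) = 1 by simp, one_pow, one_mul, coeffZ_X_pow_mul]
    rw [Cb_coeffZ]
    congr 1
    push_cast; ring_nf
  · apply Finset.sum_congr rfl
    intro j hj
    rw [Finset.mem_range] at hj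
    simp only
    rw [vzB, Cb_coeff_pos, PowerSeries.coeff_mul_C, vzxB, PowerSeries.coeff_mk, ← zsmul_eq_mul, map_zsmul, coeffZ_X_pow_mul, smul_eq_mul]
    congr 1
    rw [add_assoc, Cb_coeffZ]
    congr 1
    rw [Nat.cast_sub (by omega)]
    push_cast; ring_nf

theorem Fb_eq (s e : ℕ) (t : ℕ) : ∀ (n : ℕ) (N : ℤ), t ≤ n → n + 3 + e ≤ s →
    Fb t (n + N) s e n = coeffZ (N + t) (PowerSeries.coeff t (HB s e n)) := by
  induction t using Nat.strong_induction_on with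
  | _ t ih =>
  intro n N ht hs
  cases t with
  | zero =>
    rw [Fb, Cb_coeffZ]
    simp only [HB, PowerSeries.coeff_mul_C]
    rw [PowerSeries.coeff_zero_eq_constantCoeff, map_mul PowerSeries.constantCoeff, map_pow PowerSeries.constantCoeff, map_pow PowerSeries.constantCoeff]
    rw [show PowerSeries.constantCoeff vzB = 1 by simp [vzB]]
    rw [show PowerSeries.constantCoeff vzxB = 1 by simp [vzxB]]
    simp [vxA]
  | succ t =>
    rw [Fb, if_neg (by omega)]
    have key := congrArg (fun f => coeffZ (N + (t+1)) (PowerSeries.coeff (t+1) f)) (HB_sum s e n hs)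
    rw [GB_coeff, map_sum, map_sum] at key
    have hD : ((s - n - 3 : ℕ) : ℤ) - 1 = (s : ℤ) - n - 4 := by omega
    rw [hD] at key
    rw [← key]
    have hterm : ∀ i, coeffZ (N + (t+1)) (PowerSeries.coeff (t+1) ((e.choose i : BB) * ((PowerSeries.X * vzB * PowerSeries.C (1 - PowerSeries.X))^i * HB s e n)))
       = if i ≤ t + 1 then Cb e i * coeffZ (N + (t+1)) (PowerSeries.coeff (t + 1 - i) (HB s e (n-i))) else 0 := by
      intro i
      rw [← nsmul_eq_mul, map_nsmul, map_nsmul, nsmul_eq_mul, Cb_nat]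
      split_ifs with hi
      · rw [HB_shift s e n i hs (by omega), PowerSeries.coeff_X_pow_mul', if_pos hi]
      · rw [mul_pow, mul_pow, mul_assoc, mul_assoc, PowerSeries.coeff_X_pow_mul', if_neg hi, map_zero, mul_zero]
    rw [Finset.sum_congr rfl (fun i _ => hterm i)]
    have hext : ∑ i ∈ Finset.range (e+1), (if i ≤ t + 1 then Cb e i * coeffZ (N + (t+1)) (PowerSeries.coeff (t + 1 - i) (HB s e (n-i))) else 0)
      = ∑ i ∈ Finset.range (t+2), Cb e i * coeffZ (N + (t+1)) (PowerSeries.coeff (t + 1 - i) (HB s e (n-i))) := by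
      have a1 : ∑ i ∈ Finset.range (e+1), (if i ≤ t + 1 then Cb e i * coeffZ (N + (t+1)) (PowerSeries.coeff (t + 1 - i) (HB s e (n-i))) else 0)
         = ∑ i ∈ Finset.range (e+1+(t+2)), (if i ≤ t + 1 then Cb e i * coeffZ (N + (t+1)) (PowerSeries.coeff (t + 1 - i) (HB s e (n-i))) else 0) := by
        apply Finset.sum_subset
        · intro x hx; rw [Finset.mem_range] at *; omega
        · intro x _ hx
          rw [Finset.mem_range] at hx
          rw [Cb_nat, Nat.choose_eq_zero_of_lt (by omega)]; simp
      have a2 : ∑ i ∈ Finset.range (t+2), (if i ≤ t + 1 then Cb e i * coeffZ (N + (t+1)) (PowerSeries.coeff (t + 1 - i) (HB s e (n-i))) else 0)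
         = ∑ i ∈ Finset.range (e+1+(t+2)), (if i ≤ t + 1 then Cb e i * coeffZ (N + (t+1)) (PowerSeries.coeff (t + 1 - i) (HB s e (n-i))) else 0) := by
        apply Finset.sum_subset
        · intro x hx; rw [Finset.mem_range] at *; omega
        · intro x _ hx
          rw [Finset.mem_range] at hx
          rw [if_neg (by omega)]
      rw [a1, ← a2]
      apply Finset.sum_congr rfl
      intro i hi
      rw [Finset.mem_range] at hi
      rw [if_pos (by omega)]
    rw [hext, Finset.sum_range_succ']
    rw [Cb_nat, Nat.choose_zero_right]
    have hrest : ∑ j ∈ Finset.range (t+1), Cb (e:ℤ) ((j:ℤ)+1) * Fb (t - j) (n+N) s e (n - (j+1))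
      = ∑ i ∈ Finset.range (t+1), Cb e ((i+1 : ℕ) : ℤ) * coeffZ (N + (t+1)) (PowerSeries.coeff (t + 1 - (i+1)) (HB s e (n-(i+1)))) := by
      apply Finset.sum_congr rfl
      intro j hj
      rw [Finset.mem_range] at hj
      have := ih (t - j) (by omega) (n - (j+1)) (N + (j+1)) (by omega) (by omega)
      have e1 : ((n - (j+1) : ℕ) : ℤ) = n - (j+1) := by omega
      have e2 : ((t - j : ℕ) : ℤ) = t - j := by omega
      rw [e1, e2] at this
      rw [show (n:ℤ) - (j+1) + (N + (j+1)) = n + N by ring, show N + (j+1) + ((t:ℤ) - j) = N + (t+1) by ring] at this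
      rw [this]
      push_cast
      rfl
    rw [hrest]
    push_cast
    simp

/-- evaluate at `z = X^(k+1)` -/
def psi (k : ℕ) (f : BB) : PowerSeries ℤ :=
  PowerSeries.mk (fun d => PowerSeries.coeff d
    (∑ j ∈ Finset.range (d+1), (PowerSeries.X ^ (k+1))^j * PowerSeries.coeff j f))

theorem coeff_qpow_mul_zero (k d j : ℕ) (h : d < j) (g : PowerSeries ℤ) :
    PowerSeries.coeff d ((PowerSeries.X ^ (k+1))^j * g) = 0 := by
  rw [← pow_mul, PowerSeries.coeff_X_pow_mul', if_neg]
  nlinarith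

theorem psi_coeff (k : ℕ) (f : BB) (d M : ℕ) (h : d < M) :
    PowerSeries.coeff d (psi k f) = PowerSeries.coeff d
    (∑ j ∈ Finset.range M, (PowerSeries.X ^ (k+1))^j * PowerSeries.coeff j f) := by
  rw [psi, PowerSeries.coeff_mk, map_sum, map_sum]
  apply Finset.sum_subset
  · intro x hx; rw [Finset.mem_range] at *; omega
  · intro x _ hx
    rw [Finset.mem_range] at hx
    apply coeff_qpow_mul_zero; omega

theorem psi_sub (k : ℕ) (f g : BB) : psi k (f - g) = psi k f - psi k g := by
  ext d
  simp [psi, mul_sub]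

theorem psi_C_mul (k : ℕ) (c : PowerSeries ℤ) (f : BB) :
    psi k (PowerSeries.C c * f) = c * psi k f := by
  refine PowerSeries.ext fun d => ?_
  rw [psi_coeff k _ d (d+1) (by omega)]
  have : ∑ j ∈ Finset.range (d+1), (PowerSeries.X ^ (k+1))^j * PowerSeries.coeff j (PowerSeries.C c * f)
    = c * ∑ j ∈ Finset.range (d+1), (PowerSeries.X ^ (k+1))^j * PowerSeries.coeff j f := by
    rw [Finset.mul_sum]
    apply Finset.sum_congr rfl
    intro j _
    rw [PowerSeries.coeff_C_mul]; ring
  rw [this, PowerSeries.coeff_mul, PowerSeries.coeff_mul]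
  apply Finset.sum_congr rfl
  rintro ⟨i, j⟩ hij
  rw [Finset.HasAntidiagonal.mem_antidiagonal] at hij
  simp only at hij
  rw [psi_coeff k f j (d+1) (by omega)]

theorem psi_X_mul (k : ℕ) (f : BB) :
    psi k (PowerSeries.X * f) = PowerSeries.X ^ (k+1) * psi k f := by
  refine PowerSeries.ext fun d => ?_
  rw [psi_coeff k _ d (d+2) (by omega), Finset.sum_range_succ', map_add]
  have h0 : PowerSeries.coeff 0 (PowerSeries.X * f) = 0 := by simp
  rw [h0, mul_zero, map_zero, add_zero]
  have : ∑ j ∈ Finset.range (d+1), (PowerSeries.X ^ (k+1))^(j+1) * PowerSeries.coeff (j+1) (PowerSeries.X * f)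
    = PowerSeries.X ^ (k+1) * ∑ j ∈ Finset.range (d+1), (PowerSeries.X ^ (k+1))^j * PowerSeries.coeff j f := by
    rw [Finset.mul_sum]
    apply Finset.sum_congr rfl
    intro j _
    rw [PowerSeries.coeff_succ_X_mul]; ring
  rw [this, PowerSeries.coeff_X_pow_mul', PowerSeries.coeff_X_pow_mul']
  split_ifs with h
  · rw [psi_coeff k f _ (d+1) (by omega)]
  · rfl

theorem psi_one (k : ℕ) : psi k 1 = 1 := by
  refine PowerSeries.ext fun d => ?_
  rw [psi_coeff k _ d (d+1) (by omega), Finset.sum_range_succ']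
  simp [PowerSeries.coeff_one]

theorem psi_mul1 (k : ℕ) (f : BB) (r : ℕ) :
    psi k ((1 - PowerSeries.X)^r * f) = (1 - PowerSeries.X^(k+1))^r * psi k f := by
  induction r with
  | zero => simp
  | succ r ih =>
    rw [pow_succ', mul_assoc, sub_mul, one_mul, psi_sub, psi_X_mul, ih]; ring

theorem psi_mul2 (k : ℕ) (f : BB) (r : ℕ) :
    psi k ((1 - PowerSeries.C (PowerSeries.X : PowerSeries ℤ) * PowerSeries.X)^r * f) = (1 - PowerSeries.X^(k+2))^r * psi k f := by
  induction r with
  | zero => simp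
  | succ r ih =>
    rw [pow_succ', mul_assoc, sub_mul, one_mul, psi_sub, mul_assoc, psi_C_mul, psi_X_mul, ih]; ring

theorem psi_H (k s e n : ℕ) (h : n + 3 + e ≤ s) (vq : PowerSeries ℤ) (hvq : (1 - PowerSeries.X ^ (k+2)) * vq = 1) :
    psi k ((1 - PowerSeries.X)^s * HB s e n) = (1 - PowerSeries.X^(k+1))^(n+3+e) * vxA^(n+1) * vq^(1+e) := by
  have h1 : (1 - PowerSeries.X)^s * HB s e n = (1 - PowerSeries.X)^(n+3+e) * (PowerSeries.C (vxA^(n+1)) * vzxB^(1+e)) := by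
    have hh : s = n + 3 + e + (s - n - 3 - e) := by omega
    have h2 : (1 - PowerSeries.X : BB)^(s - n - 3 - e) * vzB^(s-n-3-e) = 1 := by
      rw [← mul_pow, vzB_mul, one_pow]
    rw [show (1 - PowerSeries.X : BB)^s = (1 - PowerSeries.X)^(n + 3 + e + (s - n - 3 - e)) by rw [← hh], HB]
    generalize PowerSeries.C (vxA^(n+1)) = cc
    rw [pow_add _ (n+3+e)]
    linear_combination ((1 - PowerSeries.X : BB)^(n+3+e) * vzxB^(1+e) * cc) * h2
  rw [h1, psi_mul1, psi_C_mul]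
  have h3 : (1 - PowerSeries.X^(k+2))^(1+e) * psi k (vzxB^(1+e)) = 1 := by
    rw [← psi_mul2, ← mul_pow, vzxB_mul, one_pow, psi_one]
  have h4 : psi k (vzxB^(1+e)) = vq^(1+e) := by
    have h5 : (1 - PowerSeries.X ^ (k+2))^(1+e) * vq^(1+e) = 1 := by rw [← mul_pow, hvq, one_pow]
    linear_combination vq^(1+e) * h3 - psi k (vzxB^(1+e)) * h5
  rw [h4, mul_assoc]

theorem one_sub_X_pow_coeff (s i : ℕ) :
    PowerSeries.coeff i ((1 - PowerSeries.X : BB)^s) = (((-1)^i * (s.choose i : ℤ) : ℤ) : PowerSeries ℤ) := by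
  induction s generalizing i with
  | zero => cases i <;> simp [PowerSeries.coeff_one]
  | succ s ih =>
    rw [pow_succ', sub_mul, one_mul, map_sub]
    cases i with
    | zero => simp
    | succ i =>
      rw [PowerSeries.coeff_succ_X_mul, ih, ih, Nat.choose_succ_succ]
      push_cast
      ring

theorem comb_identity (n d s k e : ℕ) (hs : n + 3 + e ≤ s) (hd : 2 * d + e = (n+2) * k)
    (hodd : ∀ p, n = 2 * p + 1 → d ≤ (p + 1) * k)
    (vq : PowerSeries ℤ) (hvq : (1 - PowerSeries.X ^ (k+2)) * vq = 1) :
    ∑ t ∈ (Finset.range (n+1)).filter (fun t => 2 * t ≤ n),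
      ∑ i ∈ (Finset.range (n+1)).filter (fun i => i + 2 * t ≤ n),
        (-1 : ℤ)^i * (s.choose i : ℤ) * Fb t ((n:ℤ) + ((d:ℤ) - i * (k+1) - t * (k+2))) s e n
    = PowerSeries.coeff d ((1 - PowerSeries.X^(k+1))^(n+3+e) * vxA^(n+1) * vq^(1+e)) := by
  rw [← psi_H k s e n hs vq hvq]
  set M := n + d + 1 with hM
  let g : ℕ × ℕ → ℤ := fun p => (-1 : ℤ)^p.1 * (s.choose p.1 : ℤ) *
     coeffZ ((d:ℤ) - (p.1 + p.2) * (k+1)) (PowerSeries.coeff p.2 (HB s e n))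
  have hR : PowerSeries.coeff d (psi k ((1 - PowerSeries.X)^s * HB s e n)) =
      ∑ j ∈ Finset.range M, ∑ p ∈ Finset.HasAntidiagonal.antidiagonal j, g p := by
    rw [psi_coeff k _ d M (by omega), map_sum]
    apply Finset.sum_congr rfl
    intro j _
    rw [PowerSeries.coeff_mul j ((1 - PowerSeries.X : BB)^s), Finset.mul_sum, map_sum]
    apply Finset.sum_congr rfl
    rintro ⟨i, t⟩ hit
    rw [Finset.HasAntidiagonal.mem_antidiagonal] at hit
    simp only at hit
    simp only [g]
    rw [one_sub_X_pow_coeff, mul_left_comm, ← zsmul_eq_mul, map_zsmul, smul_eq_mul, ← pow_mul, ← coeffZ_nat, coeffZ_X_pow_mul]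
    congr 3
    rw [← hit]; push_cast; ring
  have hL : ∑ t ∈ (Finset.range (n+1)).filter (fun t => 2 * t ≤ n),
      ∑ i ∈ (Finset.range (n+1)).filter (fun i => i + 2 * t ≤ n),
        (-1 : ℤ)^i * (s.choose i : ℤ) * Fb t ((n:ℤ) + ((d:ℤ) - i * (k+1) - t * (k+2))) s e n
      = ∑ t ∈ (Finset.range (n+1)).filter (fun t => 2 * t ≤ n),
      ∑ i ∈ (Finset.range (n+1)).filter (fun i => i + 2 * t ≤ n), g (i, t) := by
    apply Finset.sum_congr rfl
    intro t ht
    rw [Finset.mem_filter] at ht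
    apply Finset.sum_congr rfl
    intro i _
    simp only [g]
    rw [Fb_eq s e t n _ (by omega) hs]
    congr 3
    ring
  rw [hL, hR]
  rw [← Finset.sum_finset_product' (((Finset.range (n+1)) ×ˢ (Finset.range (n+1))).filter (fun p => p.1 + 2 * p.2 ≤ n)  |>.map ⟨Prod.swap, Prod.swap_injective⟩) _ _ (f := fun t i => g (i,t))]
  swap
  · rintro ⟨t, i⟩
    simp
    omega
  rw [Finset.sum_map]
  simp only [Function.Embedding.coeFn_mk, Prod.snd_swap, Prod.fst_swap, Prod.mk.eta]
  have hR2 : ∑ j ∈ Finset.range M, ∑ p ∈ Finset.HasAntidiagonal.antidiagonal j, g p =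
      ∑ p ∈ ((Finset.range M) ×ˢ (Finset.range M)).filter (fun p => p.1 + p.2 < M), g p := by
    rw [← Finset.sum_fiberwise_of_maps_to (s := ((Finset.range M) ×ˢ (Finset.range M)).filter (fun p => p.1 + p.2 < M)) (t := Finset.range M) (g := fun p => p.1 + p.2)]
    · apply Finset.sum_congr rfl
      intro j hj
      rw [Finset.mem_range] at hj
      apply Finset.sum_congr _ (fun _ _ => rfl)
      ext ⟨a, b⟩
      simp only [Finset.HasAntidiagonal.mem_antidiagonal, Finset.mem_filter, Finset.mem_product, Finset.mem_range]
      omega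
    · intro p hp
      rw [Finset.mem_filter] at hp
      simpa using hp.2
  rw [hR2]
  apply Finset.sum_subset
  · rintro ⟨i, t⟩ h
    simp only [Finset.mem_filter, Finset.mem_product, Finset.mem_range] at *
    omega
  · rintro ⟨i, t⟩ h h'
    simp only [Finset.mem_filter, Finset.mem_product, Finset.mem_range] at h h'
    have hgt : n < i + 2 * t := by
      by_contra hh
      exact h' ⟨by omega, by omega⟩
    simp only [g]
    rw [coeffZ_neg, mul_zero]
    by_contra hneg
    push Not at hneg
    have hle : (i + t) * (k + 1) ≤ d := by zify; linarith
    have h2 : 2 * (i + t) ≤ n + 1 := by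
      by_contra hc
      have : n + 2 ≤ 2 * (i + t) := by omega
      have := Nat.mul_le_mul_right (k+1) this
      nlinarith
    have hi : i = 0 := by omega
    subst hi
    have ht : n = 2 * (t - 1) + 1 := by omega
    have := hodd _ ht
    rw [show t - 1 + 1 = t by omega] at this
    have : 0 < t := by omega
    nlinarith


/-! ### Basic facts on derivatives and restriction to the curve -/

lemma mem_linSys_iff (n d s : ℕ) (m : Fin s → ℕ) (tp : Fin s → ℂ)
    (P : MvPolynomial (Fin (n+1)) ℂ) :
    P ∈ linSys n d s m tp ↔ P.IsHomogeneous d ∧ ∀ i, ∀ D : List (Fin (n+1)), D.length < m i →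
      MvPolynomial.eval (rncPoint n (tp i)) (derivAlong D P) = 0 := by
  simp only [linSys, Submodule.mem_inf, MvPolynomial.mem_homogeneousSubmodule,
    Submodule.mem_iInf, LinearMap.mem_ker, LinearMap.comp_apply]
  rfl

lemma derivAlong_nil {n : ℕ} (P : MvPolynomial (Fin (n+1)) ℂ) : derivAlong [] P = P := rfl

lemma derivAlong_cons {n : ℕ} (j : Fin (n+1)) (D : List (Fin (n+1)))
    (P : MvPolynomial (Fin (n+1)) ℂ) :
    derivAlong (j :: D) P = MvPolynomial.pderiv j (derivAlong D P) := rfl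

lemma pd_comm {n : ℕ} (i j : Fin (n+1)) (P : MvPolynomial (Fin (n+1)) ℂ) :
    MvPolynomial.pderiv i (MvPolynomial.pderiv j P)
      = MvPolynomial.pderiv j (MvPolynomial.pderiv i P) := by
  have h : ⁅(MvPolynomial.pderiv i :
      Derivation ℂ (MvPolynomial (Fin (n+1)) ℂ) (MvPolynomial (Fin (n+1)) ℂ)),
      (MvPolynomial.pderiv j :
        Derivation ℂ (MvPolynomial (Fin (n+1)) ℂ) (MvPolynomial (Fin (n+1)) ℂ))⁆ = 0 := by
    apply MvPolynomial.derivation_ext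
    intro l
    rw [Derivation.commutator_apply]
    simp only [MvPolynomial.pderiv_X, Pi.single_apply]
    split_ifs <;> simp
  have := congrArg (fun D => D P) h
  simp only [Derivation.commutator_apply, Derivation.zero_apply] at this
  exact sub_eq_zero.mp this

lemma derivAlong_pderiv {n : ℕ} (j : Fin (n+1)) (D : List (Fin (n+1)))
    (P : MvPolynomial (Fin (n+1)) ℂ) :
    derivAlong D (MvPolynomial.pderiv j P) = MvPolynomial.pderiv j (derivAlong D P) := by
  induction D with
  | nil => rfl
  | cons i D ih => rw [derivAlong_cons, derivAlong_cons, ih, pd_comm]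

/-- Restriction to the rational normal curve. -/
def phiR (n : ℕ) : MvPolynomial (Fin (n+1)) ℂ →ₐ[ℂ] Polynomial ℂ :=
  MvPolynomial.aeval (fun j : Fin (n+1) => (Polynomial.X : Polynomial ℂ) ^ (j : ℕ))

lemma eval_phiR (n : ℕ) (u : ℂ) (P : MvPolynomial (Fin (n+1)) ℂ) :
    (phiR n P).eval u = MvPolynomial.eval (rncPoint n u) P := by
  induction P using MvPolynomial.induction_on with
  | C a => simp [phiR]
  | add p q hp hq => simp [hp, hq]
  | mul_X p i hp => 
    rw [map_mul, Polynomial.eval_mul, hp]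
    simp [phiR, rncPoint]

lemma derivative_phiR (n : ℕ) (P : MvPolynomial (Fin (n+1)) ℂ) :
    Polynomial.derivative (phiR n P) = ∑ j : Fin (n+1), phiR n (MvPolynomial.pderiv j P) *
      Polynomial.derivative ((Polynomial.X : Polynomial ℂ) ^ (j : ℕ)) := by
  induction P using MvPolynomial.induction_on with
  | C a => simp [phiR]
  | add p q hp hq => simp [hp, hq, add_mul, Finset.sum_add_distrib]
  | mul_X p i hp => 
    have h1 : phiR n (MvPolynomial.X i) = Polynomial.X ^ (i : ℕ) := by simp [phiR]
    rw [map_mul, Polynomial.derivative_mul, hp, h1]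
    simp only [Derivation.leibniz, MvPolynomial.pderiv_X, smul_eq_mul, map_add, map_mul, h1,
      add_mul, Finset.sum_add_distrib]
    rw [add_comm]
    congr 1
    · rw [Finset.sum_eq_single i]
      · simp
      · intro b _ hb
        simp [hb.symm]
      · simp
    · rw [Finset.sum_mul]
      apply Finset.sum_congr rfl
      intros; ring

lemma natDegree_phiR (n d : ℕ) (P : MvPolynomial (Fin (n+1)) ℂ) (hP : P.IsHomogeneous d) :
    (phiR n P).natDegree ≤ n * d := by
  rw [phiR, MvPolynomial.aeval_def, MvPolynomial.eval₂_eq']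
  apply Polynomial.natDegree_sum_le_of_forall_le
  intro a ha
  have h1 : ∑ i, a i = d := by
    have := hP (MvPolynomial.mem_support_iff.mp ha)
    rw [← this, Finsupp.weight_apply, Finsupp.sum_fintype] <;> simp
  simp only [← pow_mul, Finset.prod_pow_eq_pow_sum]
  refine le_trans (Polynomial.natDegree_C_mul_X_pow_le _ _) ?_
  rw [← h1, Finset.mul_sum]
  exact Finset.sum_le_sum (fun i _ => Nat.mul_le_mul_right _ (by omega))

/-- `Van k u R`: all derivatives of order `< k` vanish at the curve point `u`. -/
def Van {n : ℕ} (k : ℕ) (u : ℂ) (R : MvPolynomial (Fin (n+1)) ℂ) : Prop :=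
  ∀ D : List (Fin (n+1)), D.length < k → MvPolynomial.eval (rncPoint n u) (derivAlong D R) = 0

lemma Van.pderiv {n k : ℕ} {u : ℂ} {R : MvPolynomial (Fin (n+1)) ℂ} (h : Van (k+1) u R)
    (j : Fin (n+1)) : Van k u (MvPolynomial.pderiv j R) := by
  intro D hD
  rw [derivAlong_pderiv, ← derivAlong_cons]
  exact h _ (by simpa using hD)

lemma Van.dvd {n : ℕ} {u : ℂ} (k : ℕ) : ∀ {R : MvPolynomial (Fin (n+1)) ℂ}, Van k u R →
    (Polynomial.X - Polynomial.C u) ^ k ∣ phiR n R := by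
  induction k with
  | zero => intro R _; simp
  | succ k ih =>
    intro R h
    have h0 : (phiR n R).IsRoot u := by
      rw [Polynomial.IsRoot, eval_phiR]
      exact h [] (by simp)
    have h1 : (Polynomial.X - Polynomial.C u) ^ k ∣ Polynomial.derivative (phiR n R) := by
      rw [derivative_phiR]
      exact Finset.dvd_sum (fun j _ => Dvd.dvd.mul_right (ih (h.pderiv j)) _)
    by_cases hz : phiR n R = 0
    · rw [hz]; exact dvd_zero _
    by_cases hz' : Polynomial.derivative (phiR n R) = 0
    · exfalso
      have := Polynomial.derivative_eq_zero.mp hz'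
      rw [Polynomial.eq_C_of_natDegree_eq_zero this] at h0 hz
      simp at h0 
      simp [h0] at hz
    rw [← Polynomial.le_rootMultiplicity_iff hz]
    rw [← Polynomial.le_rootMultiplicity_iff hz', Polynomial.derivative_rootMultiplicity_of_root h0]
      at h1
    have := (Polynomial.rootMultiplicity_pos hz).mpr h0
    omega

/-- derivative in direction of the curve point with parameter `x` -/
def Dx (n : ℕ) (x : ℂ) : MvPolynomial (Fin (n+1)) ℂ →ₗ[ℂ] MvPolynomial (Fin (n+1)) ℂ :=
  ∑ j : Fin (n+1), x ^ (j : ℕ) • (MvPolynomial.pderiv j).toLinearMap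

lemma Dx_apply (n : ℕ) (x : ℂ) (P : MvPolynomial (Fin (n+1)) ℂ) :
    Dx n x P = ∑ j : Fin (n+1), x ^ (j : ℕ) • MvPolynomial.pderiv j P := by
  simp [Dx]

lemma pderiv_Dx (n : ℕ) (x : ℂ) (i : Fin (n+1)) (P : MvPolynomial (Fin (n+1)) ℂ) :
    MvPolynomial.pderiv i (Dx n x P) = Dx n x (MvPolynomial.pderiv i P) := by
  simp only [Dx_apply, map_sum, Derivation.map_smul]
  exact Finset.sum_congr rfl (fun j _ => by rw [pd_comm])

lemma Dx_comm (n : ℕ) (x y : ℂ) (P : MvPolynomial (Fin (n+1)) ℂ) :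
    Dx n x (Dx n y P) = Dx n y (Dx n x P) := by
  rw [Dx_apply n x, Dx_apply n x, map_sum]
  exact Finset.sum_congr rfl (fun j _ => by rw [pderiv_Dx, map_smul])

def Dxs (n : ℕ) : List ℂ → MvPolynomial (Fin (n+1)) ℂ → MvPolynomial (Fin (n+1)) ℂ
  | [], P => P
  | x :: xs, P => Dx n x (Dxs n xs P)

lemma pderiv_Dxs (n : ℕ) (xs : List ℂ) (i : Fin (n+1)) (P : MvPolynomial (Fin (n+1)) ℂ) :
    MvPolynomial.pderiv i (Dxs n xs P) = Dxs n xs (MvPolynomial.pderiv i P) := by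
  induction xs with
  | nil => rfl
  | cons x xs ih => rw [Dxs, Dxs, pderiv_Dx, ih]

lemma Dxs_perm (n : ℕ) {xs ys : List ℂ} (h : xs.Perm ys) (P : MvPolynomial (Fin (n+1)) ℂ) :
    Dxs n xs P = Dxs n ys P := by
  induction h with
  | nil => rfl
  | cons x _ ih => rw [Dxs, Dxs, ih]
  | swap x y l => simp only [Dxs]; rw [Dx_comm]
  | trans _ _ h1 h2 => rw [h1, h2]

lemma Van.Dx {n k : ℕ} {u : ℂ} {R : MvPolynomial (Fin (n+1)) ℂ} (h : Van (k+1) u R)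
    (x : ℂ) : Van k u (Dx n x R) := by
  intro D hD
  rw [Dx_apply, map_sum, map_sum]
  apply Finset.sum_eq_zero
  intro j _
  rw [map_smul, MvPolynomial.smul_eval, h.pderiv j D hD, mul_zero]

lemma Van.Dxs {n : ℕ} {u : ℂ} {R : MvPolynomial (Fin (n+1)) ℂ} 
    (xs : List ℂ) : ∀ {k : ℕ}, Van (k+xs.length) u R → Van k u (Dxs n xs R) := by
  induction xs with
  | nil => intro k h; exact h
  | cons x xs ih => 
    intro k h
    rw [_root_.Dxs]
    apply Van.Dx
    apply ih
    rw [List.length_cons] at h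
    convert h using 1; ring

lemma Dx_homog {n d : ℕ} {P : MvPolynomial (Fin (n+1)) ℂ} (hP : P.IsHomogeneous d) (x : ℂ) :
    (Dx n x P).IsHomogeneous (d-1) := by
  rw [Dx_apply]
  apply MvPolynomial.IsHomogeneous.sum
  intro i _
  rw [MvPolynomial.smul_eq_C_mul]
  exact (hP.pderiv).C_mul _

lemma Dxs_homog {n d : ℕ} {P : MvPolynomial (Fin (n+1)) ℂ} (hP : P.IsHomogeneous d)
    (xs : List ℂ) : (Dxs n xs P).IsHomogeneous (d-xs.length) := by
  induction xs with
  | nil => exact hP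
  | cons x xs ih => 
    rw [Dxs, List.length_cons, ← Nat.sub_sub]
    exact Dx_homog ih x

lemma euler_eval {n d : ℕ} {P : MvPolynomial (Fin (n+1)) ℂ} (hP : P.IsHomogeneous d) (x : ℂ) :
    MvPolynomial.eval (rncPoint n x) (Dx n x P) = d * MvPolynomial.eval (rncPoint n x) P := by
  have := congrArg (MvPolynomial.eval (rncPoint n x)) hP.sum_X_mul_pderiv
  rw [Dx_apply]
  simpa [MvPolynomial.smul_eval, rncPoint] using this

lemma sq_dvd {n d : ℕ} {Q : MvPolynomial (Fin (n+1)) ℂ} (hQ : Q.IsHomogeneous d) (x : ℂ)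
    (h0 : phiR n Q = 0) : (Polynomial.X - Polynomial.C x) ^ 2 ∣ phiR n (Dx n x Q) := by
  have hr : (phiR n (Dx n x Q)).IsRoot x := by
    rw [Polynomial.IsRoot, eval_phiR, euler_eval hQ, ← eval_phiR, h0]; simp
  have hd : (Polynomial.derivative (phiR n (Dx n x Q))).IsRoot x := by
    have h1 : Polynomial.eval x (Polynomial.derivative (phiR n Q)) = 0 := by rw [h0]; simp
    rw [derivative_phiR, Polynomial.eval_finsetSum] at h1
    rw [Polynomial.IsRoot, derivative_phiR, Polynomial.eval_finsetSum]
    rw [← mul_zero (((d-1 : ℕ) : ℂ)), ← h1, Finset.mul_sum]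
    apply Finset.sum_congr rfl
    intro j _
    rw [Polynomial.eval_mul, Polynomial.eval_mul, eval_phiR, eval_phiR, pderiv_Dx,
      euler_eval hQ.pderiv]
    ring
  by_cases hz : phiR n (Dx n x Q) = 0
  · rw [hz]; exact dvd_zero _
  rw [← Polynomial.le_rootMultiplicity_iff hz]
  exact (Polynomial.one_lt_rootMultiplicity_iff_isRoot hz).mpr ⟨hr, hd⟩


/-! ### Bezout: derivatives of order `< m` vanish along the whole curve -/

lemma bezout_base (n d s mm e : ℕ) (hs : n + 3 + e ≤ s) (hnd : n * d = (n+2) * mm + e)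
    (tp : Fin s → ℂ) (htp : Function.Injective tp)
    (P : MvPolynomial (Fin (n+1)) ℂ) (hP : P.IsHomogeneous d) (hV : ∀ i, Van mm (tp i) P)
    (xs : List ℂ) (hx : xs.length < mm) (hnd' : xs.Nodup) (hav : ∀ x ∈ xs, x ∉ Set.range tp)
    (hsq : ∀ x ∈ xs, (Polynomial.X - Polynomial.C x) ^ 2 ∣ phiR n (Dxs n xs P)) :
    phiR n (Dxs n xs P) = 0 := by
  classical
  set R := phiR n (Dxs n xs P) with hR
  have h1 : (∏ x ∈ xs.toFinset, (Polynomial.X - Polynomial.C x) ^ 2) ∣ R := by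
    apply Finset.prod_dvd_of_coprime
    · intro x _ y _ hxy
      exact (Polynomial.isCoprime_X_sub_C_of_isUnit_sub (sub_ne_zero.mpr hxy).isUnit).pow
    · intro x hx; exact hsq x (by simpa using hx)
  have h2 : (∏ i : Fin s, (Polynomial.X - Polynomial.C (tp i)) ^ (mm - xs.length)) ∣ R := by
    apply Finset.prod_dvd_of_coprime
    · intro x _ y _ hxy
      exact (Polynomial.isCoprime_X_sub_C_of_isUnit_sub
        (sub_ne_zero.mpr (fun h => hxy (htp h))).isUnit).pow
    · intro i _
      apply Van.dvd
      apply Van.Dxs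
      rw [Nat.sub_add_cancel hx.le]; exact hV i
  have h3 : (∏ x ∈ xs.toFinset, (Polynomial.X - Polynomial.C x) ^ 2) *
      (∏ i : Fin s, (Polynomial.X - Polynomial.C (tp i)) ^ (mm - xs.length)) ∣ R := by
    refine IsCoprime.mul_dvd ?_ h1 h2
    apply IsCoprime.prod_left
    intro x hx
    apply IsCoprime.prod_right
    intro i _
    refine (Polynomial.isCoprime_X_sub_C_of_isUnit_sub
        (sub_ne_zero.mpr ?_).isUnit).pow
    intro h
    exact hav x (by simpa using hx) ⟨i, h.symm⟩
  have hdeg : R.natDegree ≤ n * (d - xs.length) := natDegree_phiR _ _ _ (Dxs_homog hP xs)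
  refine Polynomial.eq_zero_of_dvd_of_natDegree_lt h3 ?_
  refine lt_of_le_of_lt hdeg ?_
  rw [Polynomial.Monic.natDegree_mul, Polynomial.natDegree_prod_of_monic,
    Polynomial.natDegree_prod_of_monic]
  · simp only [Polynomial.natDegree_pow, Polynomial.natDegree_X_sub_C, Finset.sum_const,
      smul_eq_mul, List.toFinset_card_of_nodup hnd', Finset.card_univ, Fintype.card_fin, mul_one]
    obtain ⟨c, hc⟩ : ∃ c, mm = xs.length + (c + 1) := ⟨mm - xs.length - 1, by omega⟩
    have hc' : mm - xs.length = c + 1 := by omega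
    rw [hc']
    rw [hc] at hnd
    rw [Nat.mul_sub, hnd]
    have := Nat.mul_le_mul_right (c+1) hs
    have : (n+2) * (xs.length + (c+1)) + e < xs.length * 2 + s * (c + 1) + n * xs.length := by
      nlinarith [Nat.zero_le (e * c)]
    have h0 : 0 < xs.length * 2 + s * (c + 1) := by
      have : 0 < s * (c+1) := Nat.mul_pos (by omega) (by omega)
      omega
    omega
  · intro i _; exact (Polynomial.monic_X_sub_C _).pow _
  · intro i _; exact (Polynomial.monic_X_sub_C _).pow _
  · exact Polynomial.monic_prod_of_monic _ _ (fun i _ => (Polynomial.monic_X_sub_C _).pow _)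
  · exact Polynomial.monic_prod_of_monic _ _ (fun i _ => (Polynomial.monic_X_sub_C _).pow _)

lemma bezout_step (n : ℕ) (S : MvPolynomial (Fin (n+1)) ℂ) (B : Set ℂ) (hB : B.Finite)
    (h : ∀ x, x ∉ B → phiR n (Dx n x S) = 0) (i : Fin (n+1)) :
    phiR n (MvPolynomial.pderiv i S) = 0 := by
  ext l
  let q : Polynomial ℂ := ∑ j : Fin (n+1),
    Polynomial.C ((phiR n (MvPolynomial.pderiv j S)).coeff l) * Polynomial.X ^ (j : ℕ)
  have hq : q = 0 := by
    apply Polynomial.eq_zero_of_infinite_isRoot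
    apply Set.Infinite.mono (s := Bᶜ)
    · intro x hx
      have := congrArg (fun p => Polynomial.coeff p l) (h x hx)
      rw [Dx_apply] at this
      simp only [map_sum, map_smul, Polynomial.finsetSum_coeff, Polynomial.coeff_smul,
        smul_eq_mul, Polynomial.coeff_zero] at this
      show Polynomial.eval x q = 0
      rw [← this]
      simp only [q, Polynomial.eval_finsetSum, Polynomial.eval_mul, Polynomial.eval_C,
        Polynomial.eval_pow, Polynomial.eval_X]
      exact Finset.sum_congr rfl (fun _ _ => mul_comm _ _)
    · exact hB.infinite_compl
  have := congrArg (fun p => Polynomial.coeff p (i : ℕ)) hq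
  simp only [q, Polynomial.finsetSum_coeff, Polynomial.coeff_C_mul, Polynomial.coeff_X_pow,
    Polynomial.coeff_zero, mul_ite, mul_one, mul_zero, Fin.val_inj] at this
  simpa using this

lemma bezout (n d s mm e : ℕ) (hs : n + 3 + e ≤ s) (hnd : n * d = (n+2) * mm + e)
    (tp : Fin s → ℂ) (htp : Function.Injective tp)
    (P : MvPolynomial (Fin (n+1)) ℂ) (hP : P.IsHomogeneous d) (hV : ∀ i, Van mm (tp i) P)
    (j : ℕ) : j < mm → ∀ (ws : List (Fin (n+1))) (xs : List ℂ), xs.Nodup →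
      (∀ x ∈ xs, x ∉ Set.range tp) → xs.length + ws.length = j →
      phiR n (Dxs n xs (derivAlong ws P)) = 0 := by
  induction j with
  | zero =>
    intro hj ws xs hn ha hl
    obtain ⟨hx, hw⟩ : xs = [] ∧ ws = [] := by
      constructor <;> apply List.length_eq_zero_iff.mp <;> omega
    subst hx; subst hw
    exact bezout_base n d s mm e hs hnd tp htp P hP hV [] hj hn ha (by simp)
  | succ j ih => 
    intro hj ws
    induction ws with
    | nil => 
      intro xs hn ha hl
      apply bezout_base n d s mm e hs hnd tp htp P hP hV xs (by simp at hl; omega) hn ha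
      intro x hx
      have hp := List.perm_cons_erase hx
      rw [Dxs_perm n hp]
      refine sq_dvd (Dxs_homog hP _) x ?_
      refine ih (by omega) [] (xs.erase x) (hn.erase x)
        (fun y hy => ha y (List.mem_of_mem_erase hy)) ?_
      have := hp.length_eq
      simp only [List.length_cons, List.length_nil] at this hl ⊢
      omega
    | cons i ws ihw =>
      intro xs hn ha hl
      rw [derivAlong_cons, ← pderiv_Dxs]
      refine bezout_step n _ (Set.range tp ∪ {x | x ∈ xs})
        ((Set.finite_range tp).union (List.finite_toSet xs)) ?_ i
      intro x hx
      simp only [Set.mem_union, not_or] at hx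
      refine ihw (x :: xs) (List.nodup_cons.mpr ⟨hx.2, hn⟩) ?_ ?_
      · intro y hy
        rcases List.mem_cons.mp hy with h | h
        · rw [h]; exact hx.1
        · exact ha y h
      · simp only [List.length_cons] at hl ⊢; omega


/-! ### Upper bound -/

/-- weighted degree of an exponent -/
def lw {n : ℕ} (g : Fin (n+1) → ℕ) (a : Fin (n+1) →₀ ℕ) : ℕ := ∑ i, g i * a i

lemma lw_add {n : ℕ} (g : Fin (n+1) → ℕ) (a b : Fin (n+1) →₀ ℕ) :
    lw g (a + b) = lw g a + lw g b := by
  simp [lw, mul_add, Finset.sum_add_distrib]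

lemma lw_single {n : ℕ} (g : Fin (n+1) → ℕ) (i : Fin (n+1)) (c : ℕ) :
    lw g (Finsupp.single i c) = g i * c := by
  simp [lw, Finsupp.single_apply]

/-- degree, weight and quadratic weight -/
def ldeg {n : ℕ} (a : Fin (n+1) →₀ ℕ) : ℕ := lw (fun _ => 1) a
def lwt {n : ℕ} (a : Fin (n+1) →₀ ℕ) : ℕ := lw (fun i => (i : ℕ)) a
def lsq {n : ℕ} (a : Fin (n+1) →₀ ℕ) : ℕ := lw (fun i => (i : ℕ)^2) a

lemma ldeg_of_homog {n d : ℕ} {P : MvPolynomial (Fin (n+1)) ℂ} (hP : P.IsHomogeneous d)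
    {a : Fin (n+1) →₀ ℕ} (ha : P.coeff a ≠ 0) : ldeg a = d := by
  have := hP ha
  rw [← this, Finsupp.weight_apply, Finsupp.sum_fintype] <;> simp [ldeg, lw]

lemma homog_of_ldeg {n d : ℕ} {P : MvPolynomial (Fin (n+1)) ℂ} 
    (h : ∀ a : Fin (n+1) →₀ ℕ, P.coeff a ≠ 0 → ldeg a = d) : P.IsHomogeneous d := by
  intro a ha
  rw [← h a ha, Finsupp.weight_apply, Finsupp.sum_fintype] <;> simp [ldeg, lw]

lemma coeff_derivAlong {n : ℕ} (P : MvPolynomial (Fin (n+1)) ℂ) (D : List (Fin (n+1))) :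
    ∀ γ : Fin (n+1) →₀ ℕ, ∃ c : ℂ, c ≠ 0 ∧ (derivAlong D P).coeff γ =
      c * P.coeff (γ + Multiset.toFinsupp (D : Multiset (Fin (n+1)))) := by
  induction D with
  | nil => intro γ; exact ⟨1, one_ne_zero, by simp [derivAlong_nil]⟩
  | cons j D ih =>
    intro γ
    obtain ⟨c, hc, h⟩ := ih (γ + Finsupp.single j 1)
    refine ⟨c * (γ j + 1), mul_ne_zero hc (Nat.cast_add_one_ne_zero _), ?_⟩
    rw [derivAlong_cons, MvPolynomial.coeff_pderiv, h, ← Multiset.cons_coe,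
      ← Multiset.singleton_add, map_add, Multiset.toFinsupp_singleton, add_assoc]
    ring

lemma exists_list {n : ℕ} (α : Fin (n+1) →₀ ℕ) : ∃ D : List (Fin (n+1)),
    Multiset.toFinsupp (D : Multiset (Fin (n+1))) = α ∧ D.length = ldeg α := by
  refine ⟨(Finsupp.toMultiset α).toList, by simp, ?_⟩
  rw [Multiset.length_toList, Finsupp.card_toMultiset, Finsupp.sum_fintype] <;> simp [ldeg, lw]

lemma coeff_phiR {n : ℕ} (Q : MvPolynomial (Fin (n+1)) ℂ) (l : ℕ) :
    (phiR n Q).coeff l = ∑ γ ∈ Q.support, if lwt γ = l then Q.coeff γ else 0 := by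
  rw [phiR, MvPolynomial.aeval_def, MvPolynomial.eval₂_eq', Polynomial.finsetSum_coeff]
  apply Finset.sum_congr rfl
  intro γ _
  simp only [← pow_mul, Finset.prod_pow_eq_pow_sum]
  rw [← Polynomial.C_eq_algebraMap, Polynomial.coeff_C_mul_X_pow]
  simp only [lwt, lw, eq_comm]

lemma exponent_rigid {n : ℕ} (i : Fin n) (p q : ℕ) (γ : Fin (n+1) →₀ ℕ)
    (h1 : ldeg γ = ldeg (Finsupp.single i.castSucc p + Finsupp.single i.succ q))
    (h2 : lwt γ = lwt (Finsupp.single i.castSucc p + Finsupp.single i.succ q))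
    (h3 : lsq γ ≤ lsq (Finsupp.single i.castSucc p + Finsupp.single i.succ q)) :
    γ = Finsupp.single i.castSucc p + Finsupp.single i.succ q := by
  have key : ∑ l : Fin (n+1), ((l : ℤ) - i) * ((l : ℤ) - i - 1) * (γ l : ℤ) ≤ 0 := by
    have e : ∑ l : Fin (n+1), ((l : ℤ) - i) * ((l : ℤ) - i - 1) * (γ l : ℤ)
      = (lsq γ : ℤ) - (2 * i + 1) * lwt γ + i * (i+1) * ldeg γ := by
      simp only [lsq, lwt, ldeg, lw]
      push_cast
      rw [Finset.mul_sum, Finset.mul_sum, ← Finset.sum_sub_distrib, ← Finset.sum_add_distrib]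
      apply Finset.sum_congr rfl
      intros; ring
    rw [e, h1, h2]
    have h3' : (lsq γ : ℤ) ≤ _ := Int.ofNat_le.mpr h3
    refine le_trans (add_le_add_left (sub_le_sub_right h3' _) _) ?_
    simp only [lsq, lwt, ldeg, lw_add, lw_single]
    push_cast [Fin.val_castSucc, Fin.val_succ]
    apply le_of_eq; ring
  have nn : ∀ l : Fin (n+1), 0 ≤ ((l : ℤ) - i) * ((l : ℤ) - i - 1) * (γ l : ℤ) := by
    intro l
    apply mul_nonneg _ (by positivity)
    rcases le_or_gt (l : ℤ) i with h | h
    · nlinarith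
    · exact mul_nonneg (by omega) (by omega)
  have zz : ∀ l : Fin (n+1), ((l : ℤ) - i) * ((l : ℤ) - i - 1) * (γ l : ℤ) = 0 := by
    intro l
    exact (Finset.sum_eq_zero_iff_of_nonneg (fun l _ => nn l)).mp
      (le_antisymm key (Finset.sum_nonneg (fun l _ => nn l))) l (Finset.mem_univ _)
  have hne : i.castSucc ≠ i.succ := by
    intro h; have := congrArg Fin.val h; simp at this
  have hγ : γ = Finsupp.single i.castSucc (γ i.castSucc) + Finsupp.single i.succ (γ i.succ) := by
    ext l
    rw [Finsupp.add_apply, Finsupp.single_apply, Finsupp.single_apply]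
    by_cases ha : i.castSucc = l
    · subst ha; simp [hne.symm]
    by_cases hb : i.succ = l
    · subst hb; simp [hne]
    rw [if_neg ha, if_neg hb]
    have := zz l
    have ha' : (l : ℤ) - i ≠ 0 := by
      intro h; apply ha; ext; simp; omega
    have hb' : (l : ℤ) - i - 1 ≠ 0 := by
      intro h; apply hb; ext; simp; omega
    simpa [ha', hb'] using this
  rw [hγ] at h1 h2
  simp only [lwt, ldeg, lw_add, lw_single, Fin.val_castSucc, Fin.val_succ] at h1 h2
  have hq : γ i.succ = q := by nlinarith
  have hp : γ i.castSucc = p := by omega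
  rw [hγ, hq, hp]

lemma upper_inj {n d k mm : ℕ} (hn : 1 ≤ n) (hm : 1 ≤ mm) (hd : d = k + mm)
    (P : MvPolynomial (Fin (n+1)) ℂ)
    (hP : P.IsHomogeneous d)
    (h : ∀ D : List (Fin (n+1)), D.length = mm - 1 → phiR n (derivAlong D P) = 0)
    (ha : ∀ a : Fin (n+1) →₀ ℕ, (a : Fin (n+1) → ℕ) ∈ Adm k n d (k+1) → P.coeff a = 0) :
    P = 0 := by
  by_contra hP0
  obtain ⟨a, has, hmax⟩ := Finset.exists_max_image P.support lsq
    (MvPolynomial.support_nonempty.mpr hP0)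
  have hca := MvPolynomial.mem_support_iff.mp has
  have hda := ldeg_of_homog hP hca
  obtain ⟨i, hi⟩ : ∃ i : Fin n, k + 1 ≤ a i.castSucc + a i.succ := by
    by_contra hcon
    push Not at hcon
    apply hca
    apply ha
    rw [mem_Adm]
    refine ⟨by simpa [ldeg, lw] using hda, fun i => Nat.lt_succ_iff.mp (hcon i), ?_⟩
    have := hcon ⟨0, hn⟩
    have h0 : (⟨0, hn⟩ : Fin n).castSucc = 0 := rfl
    rw [h0] at this
    omega
  obtain ⟨p, q, hp, hq, hpq⟩ : ∃ p q, p ≤ a i.castSucc ∧ q ≤ a i.succ ∧ p + q = k + 1 :=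
    ⟨min (a i.castSucc) (k+1), k + 1 - min (a i.castSucc) (k+1), by omega, by omega, by omega⟩
  set β : Fin (n+1) →₀ ℕ := Finsupp.single i.castSucc p + Finsupp.single i.succ q with hβ
  have hne : i.castSucc ≠ i.succ := by
    intro h; have := congrArg Fin.val h; simp at this
  have hβa : β ≤ a := by
    intro l
    rw [hβ, Finsupp.add_apply, Finsupp.single_apply, Finsupp.single_apply]
    by_cases h1 : i.castSucc = l
    · subst h1; simp [hne.symm, hp]
    by_cases h2 : i.succ = l
    · subst h2; simp [hne, hq]
    simp [h1, h2]
  obtain ⟨α, hα⟩ := exists_add_of_le hβa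
  obtain ⟨D, hD, hDl⟩ := exists_list α
  have hβd : ldeg β = k + 1 := by simp [hβ, ldeg, lw_add, lw_single, hpq]
  have hαd : ldeg α + (k + 1) = d := by
    rw [← hda, hα, ← hβd]; simp only [ldeg, lw_add]; ring
  have hz := congrArg (fun r => Polynomial.coeff r (lwt β)) (h D (by omega))
  simp only [coeff_phiR, Polynomial.coeff_zero] at hz
  obtain ⟨c, hc, hcc⟩ := coeff_derivAlong P D β
  rw [Finset.sum_eq_single β] at hz
  · rw [if_pos rfl, hcc, hD, ← hα] at hz
    exact (mul_ne_zero hc hca) hz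
  · intro γ hγ hγβ
    rw [if_neg]
    intro hw
    apply hγβ
    rw [MvPolynomial.mem_support_iff] at hγ
    obtain ⟨c', hc', hcc'⟩ := coeff_derivAlong P D γ
    rw [hcc', hD] at hγ
    have hγ' := right_ne_zero_of_mul hγ
    have h1 := ldeg_of_homog hP hγ'
    have h2 := hmax _ (MvPolynomial.mem_support_iff.mpr hγ')
    apply exponent_rigid
    · rw [← hβ, hβd]
      simp only [ldeg, lw_add] at h1 hαd ⊢
      omega
    · exact hw
    · rw [hα] at h2
      simp only [lsq, lw_add] at h2 ⊢
      rw [hβ] at h2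
      simp only [lw_add] at h2
      omega
  · intro hγ
    rw [if_pos rfl]
    exact MvPolynomial.notMem_support_iff.mp hγ


/-! ### Lower bound -/

/-- the ideal of a curve point (of the line through it, evaluated at the vector) -/
def Iu (n : ℕ) (u : ℂ) : Ideal (MvPolynomial (Fin (n+1)) ℂ) :=
  RingHom.ker (MvPolynomial.eval (rncPoint n u))

lemma mem_Iu {n : ℕ} {u : ℂ} {P : MvPolynomial (Fin (n+1)) ℂ} :
    P ∈ Iu n u ↔ MvPolynomial.eval (rncPoint n u) P = 0 := RingHom.mem_ker

lemma pderiv_mem_Iu_pow {n : ℕ} {u : ℂ} (j : Fin (n+1)) (m : ℕ) :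
    ∀ P ∈ (Iu n u) ^ (m+1), MvPolynomial.pderiv j P ∈ (Iu n u) ^ m := by
  induction m with
  | zero => intro P _; simp
  | succ m ih =>
    intro P hP
    rw [pow_succ] at hP
    refine Submodule.mul_induction_on hP ?_ ?_
    · intro a ha b hb
      rw [Derivation.leibniz, smul_eq_mul, smul_eq_mul]
      refine Ideal.add_mem _ (Ideal.mul_mem_right _ _ ha) ?_
      rw [mul_comm, pow_succ]
      exact Ideal.mul_mem_mul (ih a ha) hb
    · intro a b ha hb
      rw [map_add]; exact Ideal.add_mem _ ha hb

lemma derivAlong_mem_Iu_pow {n : ℕ} {u : ℂ} (D : List (Fin (n+1))) (P : MvPolynomial (Fin (n+1)) ℂ) :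
    ∀ m, P ∈ (Iu n u) ^ (m + D.length) → derivAlong D P ∈ (Iu n u) ^ m := by
  induction D with
  | nil => intro m h; exact h
  | cons j D ih =>
    intro m h
    rw [derivAlong_cons]
    apply pderiv_mem_Iu_pow
    apply ih
    rw [List.length_cons] at h
    convert h using 2; ring

lemma Van_of_mem {n : ℕ} {u : ℂ} {m : ℕ} {P : MvPolynomial (Fin (n+1)) ℂ}
    (h : P ∈ (Iu n u) ^ m) : Van m u P := by
  intro D hD
  rw [← mem_Iu]
  have := derivAlong_mem_Iu_pow D P (m - D.length) (by rwa [Nat.sub_add_cancel hD.le])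
  exact Ideal.pow_le_self (by omega) this

/-- `a` is the leading exponent of `P` for the quadratic weight, with coefficient one. -/
def Lead {n : ℕ} (P : MvPolynomial (Fin (n+1)) ℂ) (a : Fin (n+1) →₀ ℕ) : Prop :=
  P.coeff a = 1 ∧ ∀ b, P.coeff b ≠ 0 → b = a ∨ lsq b < lsq a

lemma Lead.mul {n : ℕ} {P Q : MvPolynomial (Fin (n+1)) ℂ} {a b : Fin (n+1) →₀ ℕ}
    (hP : Lead P a) (hQ : Lead Q b) : Lead (P * Q) (a + b) := by
  classical
  constructor
  · rw [MvPolynomial.coeff_mul, Finset.sum_eq_single (a, b)]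
    · simp [hP.1, hQ.1]
    · rintro ⟨x, y⟩ hxy hne
      rw [Finset.HasAntidiagonal.mem_antidiagonal] at hxy
      simp only at hxy ⊢
      by_contra hcon
      have h1 := hP.2 x (left_ne_zero_of_mul hcon)
      have h2 := hQ.2 y (right_ne_zero_of_mul hcon)
      have h3 := congrArg lsq hxy
      simp only [lsq, lw_add] at h1 h2 h3
      rcases h1 with h1 | h1
      · rcases h2 with h2 | h2
        · exact hne (by rw [h1, h2])
        · rw [h1] at h3; omega
      · rcases h2 with h2 | h2
        · rw [h2] at h3; omega
        · omega
    · intro h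
      exfalso
      apply h
      rw [Finset.HasAntidiagonal.mem_antidiagonal]
  · intro c hc
    rw [MvPolynomial.coeff_mul] at hc
    obtain ⟨⟨x, y⟩, hxy, hne⟩ := Finset.exists_ne_zero_of_sum_ne_zero hc
    rw [Finset.HasAntidiagonal.mem_antidiagonal] at hxy
    simp only at hxy hne
    have h1 := hP.2 x (left_ne_zero_of_mul hne)
    have h2 := hQ.2 y (right_ne_zero_of_mul hne)
    rw [← hxy]
    simp only [lsq, lw_add] at h1 h2 ⊢
    rcases h1 with h1 | h1
    · rcases h2 with h2 | h2
      · left; rw [h1, h2]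
      · right; rw [h1]; omega
    · right
      rcases h2 with h2 | h2
      · rw [h2]; omega
      · omega

/-- variable with natural number index -/
def Xv (n l : ℕ) : MvPolynomial (Fin (n+1)) ℂ := MvPolynomial.X (Fin.ofNat (n+1) l)

lemma eval_Xv {n l : ℕ} (h : l ≤ n) (u : ℂ) :
    MvPolynomial.eval (rncPoint n u) (Xv n l) = u ^ l := by
  simp [Xv, rncPoint, Fin.ofNat, Nat.mod_eq_of_lt (Nat.lt_succ_iff.mpr h)]

/-- Hankel matrix -/
def Hk (n t : ℕ) (r : Fin (t+1) → ℕ) :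
    Matrix (Fin (t+1)) (Fin (t+1)) (MvPolynomial (Fin (n+1)) ℂ) :=
  Matrix.of (fun i j => Xv n (r i + j))

lemma Hk_mem {n t : ℕ} (r : Fin (t+1) → ℕ) (hr : ∀ i, r i + t ≤ n) (u : ℂ) :
    (Hk n t r).det ∈ (Iu n u) ^ t := by
  let M' : Matrix (Fin (t+1)) (Fin (t+1)) (MvPolynomial (Fin (n+1)) ℂ) :=
    Matrix.of (fun i j => Fin.cases (Xv n (r i))
      (fun j : Fin t => Xv n (r i + j + 1) - MvPolynomial.C u * Xv n (r i + j)) j)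
  have h : (Hk n t r).det = M'.det := by
    apply Matrix.det_eq_of_forall_col_eq_smul_add_pred (fun _ => MvPolynomial.C u)
    · intro i; simp [Hk, M']
    · intro i j; simp [Hk, M', add_assoc]
  rw [h, Matrix.det_apply]
  apply Ideal.sum_mem
  intro σ _
  rw [Units.smul_def, zsmul_eq_mul]
  apply Ideal.mul_mem_left
  rw [Fin.prod_univ_succ]
  apply Ideal.mul_mem_left
  have : (Iu n u) ^ t = ∏ _i : Fin t, Iu n u := by simp
  rw [this]
  apply Ideal.prod_mem_prod
  intro i _
  rw [mem_Iu]
  have h1 := hr (σ i.succ)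
  have h2 := i.isLt
  simp only [M', Matrix.of_apply, Fin.cases_succ, map_sub, map_mul, MvPolynomial.eval_C]
  rw [eval_Xv (by omega), eval_Xv (by omega), pow_succ]
  ring

/-- exponents occurring in Hankel minors -/
def hexp (n t : ℕ) (r : Fin (t+1) → ℕ) (σ : Equiv.Perm (Fin (t+1))) : Fin (n+1) →₀ ℕ :=
  ∑ i, Finsupp.single (Fin.ofNat (n+1) (r (σ i) + i)) 1

lemma lw_sum {n : ℕ} {ι : Type*} (g : Fin (n+1) → ℕ) (S : Finset ι) (f : ι → Fin (n+1) →₀ ℕ) :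
    lw g (∑ i ∈ S, f i) = ∑ i ∈ S, lw g (f i) := by
  classical
  induction S using Finset.induction_on with
  | empty => simp [lw]
  | insert a S ha ih => rw [Finset.sum_insert ha, Finset.sum_insert ha, lw_add, ih]

lemma lsq_hexp {n t : ℕ} (r : Fin (t+1) → ℕ) (hr : ∀ i, r i + t ≤ n)
    (σ : Equiv.Perm (Fin (t+1))) :
    lsq (hexp n t r σ) = ∑ i, (r i)^2 + 2 * ∑ i, r (σ i) * (i : ℕ) + ∑ i : Fin (t+1), (i : ℕ)^2 := by
  rw [lsq, hexp, lw_sum, ← Equiv.sum_comp σ (fun i => (r i)^2), Finset.mul_sum,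
    ← Finset.sum_add_distrib, ← Finset.sum_add_distrib]
  apply Finset.sum_congr rfl
  intro i _
  rw [lw_single]
  have h1 := hr (σ i)
  have h2 := i.isLt
  have : ((Fin.ofNat (n+1) (r (σ i) + i) : Fin (n+1)) : ℕ) = r (σ i) + i := by
    simp only [Fin.ofNat]; apply Nat.mod_eq_of_lt; omega
  rw [this]; ring

lemma lsq_hexp_lt {n t : ℕ} (r : Fin (t+1) → ℕ) (hm : StrictMono r) (hr : ∀ i, r i + t ≤ n)
    (σ : Equiv.Perm (Fin (t+1))) (hσ : σ ≠ 1) : lsq (hexp n t r σ) < lsq (hexp n t r 1) := by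
  rw [lsq_hexp r hr, lsq_hexp r hr]
  have hmv : Monovary r (fun i : Fin (t+1) => (i : ℕ)) := by
    intro i j h; exact hm.monotone (le_of_lt h)
  have := (hmv.sum_comp_perm_mul_lt_sum_mul_iff (σ := σ)).mpr (by
    intro hmon
    apply hσ
    have hs : StrictMono σ := by
      intro i j hij
      have h1 := hmon (i := i) (j := j) hij
      simp only [Function.comp] at h1
      exact lt_of_le_of_ne (hm.le_iff_le.mp h1) (fun h => (ne_of_lt hij) (σ.injective h))
    have := (StrictMono.range_inj hs strictMono_id).mp (by simp)
    ext i
    rw [this]; simp)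
  simp only [Equiv.Perm.coe_one, id] at this ⊢
  omega

lemma Hk_det_eq {n t : ℕ} (r : Fin (t+1) → ℕ) : (Hk n t r).det =
    ∑ σ : Equiv.Perm (Fin (t+1)), Equiv.Perm.sign σ • MvPolynomial.monomial (hexp n t r σ) (1 : ℂ) := by
  rw [Matrix.det_apply]
  apply Finset.sum_congr rfl
  intro σ _
  congr 1
  rw [hexp, MvPolynomial.monomial_sum_one]
  apply Finset.prod_congr rfl
  intro i _
  simp [Hk, Xv, MvPolynomial.X]

lemma Hk_lead {n t : ℕ} (r : Fin (t+1) → ℕ) (hm : StrictMono r) (hr : ∀ i, r i + t ≤ n) :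
    Lead (Hk n t r).det (hexp n t r 1) := by
  classical
  have hc : ∀ b, (Hk n t r).det.coeff b = ∑ σ : Equiv.Perm (Fin (t+1)),
      (Equiv.Perm.sign σ : ℤ) • (if hexp n t r σ = b then (1 : ℂ) else 0) := by
    intro b
    rw [Hk_det_eq, MvPolynomial.coeff_sum]
    apply Finset.sum_congr rfl
    intro σ _
    rw [Units.smul_def, MvPolynomial.coeff_smul, MvPolynomial.coeff_monomial]
  constructor
  · rw [hc, Finset.sum_eq_single 1]
    · simp
    · intro σ _ hσ
      have := lsq_hexp_lt r hm hr σ hσ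
      rw [if_neg, smul_zero]
      intro h; rw [h] at this; exact lt_irrefl _ this
    · simp
  · intro b hb
    rw [hc] at hb
    obtain ⟨σ, _, hσ⟩ := Finset.exists_ne_zero_of_sum_ne_zero hb
    have h : hexp n t r σ = b := by
      by_contra h; rw [if_neg h, smul_zero] at hσ; exact hσ rfl
    by_cases h1 : σ = 1
    · left; rw [← h, h1]
    · right; rw [← h]; exact lsq_hexp_lt r hm hr σ h1

lemma Hk_homog {n t : ℕ} (r : Fin (t+1) → ℕ) : (Hk n t r).det.IsHomogeneous (t+1) := by
  rw [Hk_det_eq]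
  apply MvPolynomial.IsHomogeneous.sum
  intro σ _
  rw [Units.smul_def, zsmul_eq_mul]
  have h0 : ((Equiv.Perm.sign σ : ℤ) : MvPolynomial (Fin (n+1)) ℂ)
      = MvPolynomial.C ((Equiv.Perm.sign σ : ℤ) : ℂ) := by simp
  rw [h0]
  apply MvPolynomial.IsHomogeneous.C_mul
  apply homog_of_ldeg
  intro a ha
  rw [MvPolynomial.coeff_monomial] at ha
  have h : hexp n t r σ = a := by
    by_contra h; simp [h] at ha
  rw [← h, ldeg, hexp, lw_sum]
  simp [lw_single]

lemma hankel_exists {n : ℕ} (B : Finset (Fin (n+1))) (hB : B.Nonempty)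
    (hadj : ∀ i : Fin n, ¬ (i.castSucc ∈ B ∧ i.succ ∈ B)) :
    ∃ P : MvPolynomial (Fin (n+1)) ℂ, P.IsHomogeneous B.card ∧
      (∀ u, P ∈ (Iu n u) ^ (B.card - 1)) ∧ Lead P (∑ b ∈ B, Finsupp.single b 1) := by
  obtain ⟨t, ht⟩ : ∃ t, B.card = t + 1 := ⟨B.card - 1, by have := hB.card_pos; omega⟩
  let emb := B.orderEmbOfFin ht
  have hstep : ∀ i : Fin t, ((emb i.castSucc : Fin (n+1)) : ℕ) + 2 ≤ (emb i.succ : Fin (n+1)) := by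
    intro i
    have h1 : emb i.castSucc < emb i.succ := emb.strictMono (Fin.castSucc_lt_succ)
    have h2 : emb i.castSucc ∈ B := Finset.orderEmbOfFin_mem _ _ _
    have h3 : emb i.succ ∈ B := Finset.orderEmbOfFin_mem _ _ _
    rw [Fin.lt_def] at h1
    by_contra hcon
    have h4 := (emb i.succ).isLt
    refine hadj ⟨(emb i.castSucc : Fin (n+1)), by omega⟩ ⟨?_, ?_⟩
    · have e : (⟨(emb i.castSucc : Fin (n+1)), by omega⟩ : Fin n).castSucc = emb i.castSucc := rfl
      rw [e]; exact h2
    · convert h3 using 1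
      ext; simp only [Fin.succ_mk]; omega
  have hge : ∀ i : Fin (t+1), (i : ℕ) ≤ (emb i : Fin (n+1)) := by
    intro i
    induction i using Fin.induction with
    | zero => simp
    | succ i ih => have := hstep i; simp only [Fin.val_succ, Fin.val_castSucc] at ih ⊢; omega
  let r : Fin (t+1) → ℕ := fun i => (emb i : Fin (n+1)) - (i : ℕ)
  have hm : StrictMono r := by
    rw [Fin.strictMono_iff_lt_succ]
    intro i
    have h1 := hstep i
    have h2 := hge i.castSucc
    simp only [r, Fin.val_succ, Fin.val_castSucc] at h2 ⊢
    omega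
  have hr : ∀ i, r i + t ≤ n := by
    intro i
    have h1 : r i ≤ r (Fin.last t) := hm.monotone (Fin.le_last i)
    have h2 := hge (Fin.last t)
    have h3 := (emb (Fin.last t)).isLt
    simp only [r, Fin.val_last] at h1 h2 ⊢
    omega
  refine ⟨(Hk n t r).det, ?_, ?_, ?_⟩
  · rw [ht]; exact Hk_homog r
  · intro u; rw [ht]; exact Hk_mem r hr u
  · convert Hk_lead r hm hr using 1
    conv_lhs => rw [← Finset.map_orderEmbOfFin_univ B ht]
    rw [Finset.sum_map, hexp]
    apply Finset.sum_congr rfl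
    intro i _
    congr 1
    ext
    have h1 := hge i
    have h2 := (emb i).isLt
    simp only [Fin.ofNat, Equiv.Perm.coe_one, id, r]
    rw [Nat.sub_add_cancel h1, Nat.mod_eq_of_lt h2]
    rfl


/-- greedy choice of indices -/
def gB (a : ℕ → ℕ) : ℕ → Prop
  | 0 => 0 < a 0
  | (i+1) => 0 < a (i+1) ∧ ¬ gB a i

lemma gB_pos {a : ℕ → ℕ} {i : ℕ} (h : gB a i) : 0 < a i := by
  cases i with
  | zero => exact h
  | succ i => exact h.1

lemma sum_single_apply {n : ℕ} (B : Finset (Fin (n+1))) (l : Fin (n+1)) [Decidable (l ∈ B)] :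
    (∑ b ∈ B, (Finsupp.single b 1 : Fin (n+1) →₀ ℕ)) l = if l ∈ B then 1 else 0 := by
  rw [Finsupp.finsetSum_apply]
  simp [Finsupp.single_apply]

lemma greedy {n : ℕ} (k : ℕ) (a : Fin (n+1) →₀ ℕ) (ha : a ≠ 0)
    (hk : ∀ i : Fin n, a i.castSucc + a i.succ ≤ k + 1) :
    ∃ (B : Finset (Fin (n+1))) (a1 : Fin (n+1) →₀ ℕ), B.Nonempty ∧
      (∀ i : Fin n, ¬ (i.castSucc ∈ B ∧ i.succ ∈ B)) ∧
      a = a1 + ∑ b ∈ B, Finsupp.single b 1 ∧ 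
      (∀ i : Fin n, a1 i.castSucc + a1 i.succ ≤ k) := by
  classical
  let a' : ℕ → ℕ := fun l => a (Fin.ofNat (n+1) l)
  have ha' : ∀ i : Fin (n+1), a' i = a i := by
    intro i; simp [a']
  let B : Finset (Fin (n+1)) := Finset.univ.filter (fun i => gB a' i)
  have hB : ∀ i, i ∈ B ↔ gB a' i := by intro i; simp [B]
  have hBs : ∀ i : Fin n, i.succ ∈ B ↔ (0 < a i.succ ∧ i.castSucc ∉ B) := by
    intro i
    rw [hB, hB, ← ha' i.succ]; rfl
  have hB0 : (0 : Fin (n+1)) ∈ B ↔ 0 < a 0 := by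
    rw [hB, ← ha' 0]; rfl
  have hpos : ∀ i ∈ B, 0 < a i := by
    intro i hi; rw [← ha' i]; exact gB_pos ((hB i).mp hi)
  have hle : (∑ b ∈ B, Finsupp.single b 1) ≤ a := by
    intro l
    rw [sum_single_apply]
    split_ifs with h
    · exact hpos l h
    · exact Nat.zero_le _
  obtain ⟨a1, ha1⟩ := exists_add_of_le hle
  refine ⟨B, a1, ?_, ?_, ha1.trans (add_comm _ _), ?_⟩
  · obtain ⟨i, hi⟩ : ∃ i, a i ≠ 0 := by
      by_contra h; push Not at h; exact ha (Finsupp.ext h)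
    by_cases h : i ∈ B
    · exact ⟨i, h⟩
    · revert hi h
      refine Fin.cases ?_ ?_ i
      · intro h1 h2; exact absurd (hB0.mpr (Nat.pos_of_ne_zero h1)) h2
      · intro j h1 h2
        rw [hBs] at h2
        refine ⟨j.castSucc, ?_⟩
        by_contra h3
        exact h2 ⟨Nat.pos_of_ne_zero h1, h3⟩
  · rintro i ⟨h1, h2⟩
    exact ((hBs i).mp h2).2 h1
  · intro i
    have hv : ∀ l, a l = (if l ∈ B then 1 else 0) + a1 l := by
      intro l
      conv_lhs => rw [ha1]
      rw [Finsupp.add_apply, sum_single_apply]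
    have h1 := hv i.castSucc
    have h2 := hv i.succ
    have h3 := hk i
    by_cases c1 : i.castSucc ∈ B
    · rw [if_pos c1] at h1; omega
    by_cases c2 : i.succ ∈ B
    · rw [if_pos c2] at h2; omega
    rw [if_neg c1] at h1
    rw [if_neg c2] at h2
    rw [hBs] at c2
    have h4 : a i.succ = 0 := by
      by_contra h
      exact c2 ⟨Nat.pos_of_ne_zero h, c1⟩
    by_cases h5 : a i.castSucc = 0
    · omega
    -- now castSucc i is a successor
    obtain ⟨i, hi⟩ := i
    cases i with
    | zero => exact absurd (hB0.mpr (Nat.pos_of_ne_zero h5)) c1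
    | succ j =>
      have e : (⟨j+1, hi⟩ : Fin n).castSucc = (⟨j, by omega⟩ : Fin n).succ := rfl
      rw [e] at c1 h5 h1 ⊢
      rw [hBs] at c1
      have h6 : (⟨j, by omega⟩ : Fin n).castSucc ∈ B := by
        by_contra h
        exact c1 ⟨Nat.pos_of_ne_zero h5, h⟩
      have h7 := hpos _ h6
      have h8 := hk ⟨j, by omega⟩
      omega

lemma ldeg_zero {n : ℕ} : ldeg (0 : Fin (n+1) →₀ ℕ) = 0 := by simp [ldeg, lw]

lemma lower_exists {n : ℕ} (hn : 1 ≤ n) (k : ℕ) : ∀ a : Fin (n+1) →₀ ℕ,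
    (∀ i : Fin n, a i.castSucc + a i.succ ≤ k) → 
    ∃ P : MvPolynomial (Fin (n+1)) ℂ, P.IsHomogeneous (ldeg a) ∧
      (∀ u, P ∈ (Iu n u) ^ (ldeg a - k)) ∧ Lead P a := by
  classical
  have hzero : ∀ k, ∃ P : MvPolynomial (Fin (n+1)) ℂ, P.IsHomogeneous (ldeg (0 : Fin (n+1) →₀ ℕ)) ∧
      (∀ u, P ∈ (Iu n u) ^ (ldeg (0 : Fin (n+1) →₀ ℕ) - k)) ∧ Lead P 0 := by
    intro k
    refine ⟨1, ?_, ?_, ?_, ?_⟩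
    · rw [ldeg_zero]; exact MvPolynomial.isHomogeneous_one _ _
    · intro u; rw [ldeg_zero]; simp
    · simp
    · intro b hb
      left
      by_contra h
      rw [MvPolynomial.coeff_one, if_neg (Ne.symm h)] at hb
      exact hb rfl
  induction k with
  | zero =>
    intro a h
    have : a = 0 := by
      ext i
      refine Fin.cases ?_ ?_ i
      · have := h ⟨0, hn⟩
        have e : (⟨0, hn⟩ : Fin n).castSucc = 0 := rfl
        rw [e] at this
        rw [Finsupp.coe_zero, Pi.zero_apply]; omega
      · intro j
        have := h j
        rw [Finsupp.coe_zero, Pi.zero_apply]; omega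
    rw [this]; exact hzero 0
  | succ k ih =>
    intro a h
    by_cases ha : a = 0
    · rw [ha]; exact hzero _
    obtain ⟨B, a1, hB, hadj, haa, h1⟩ := greedy k a ha h
    obtain ⟨P, hP1, hP2, hP3⟩ := ih a1 h1
    obtain ⟨Q, hQ1, hQ2, hQ3⟩ := hankel_exists B hB hadj
    have hdeg : ldeg a = ldeg a1 + B.card := by
      rw [haa, ldeg, lw_add, lw_sum]
      simp [lw_single, ldeg]
    refine ⟨P * Q, ?_, ?_, ?_⟩
    · rw [hdeg]; exact hP1.mul hQ1
    · intro u
      have := Ideal.mul_mem_mul (hP2 u) (hQ2 u)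
      rw [← pow_add] at this
      refine Ideal.pow_le_pow_right ?_ this
      omega
    · rw [haa]; exact hP3.mul hQ3

lemma lead_indep {n : ℕ} {ι : Type*} [Fintype ι] (f : ι → (Fin (n+1) →₀ ℕ))
    (hf : Function.Injective f) (P : ι → MvPolynomial (Fin (n+1)) ℂ)
    (hP : ∀ i, Lead (P i) (f i)) : LinearIndependent ℂ P := by
  classical
  rw [Fintype.linearIndependent_iff]
  intro g hg
  by_contra hcon
  push Not at hcon
  obtain ⟨i0, hi0⟩ := hcon
  obtain ⟨i, hi, hmax⟩ := Finset.exists_max_image (Finset.univ.filter (fun i => g i ≠ 0))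
    (fun i => lsq (f i)) ⟨i0, by simpa using hi0⟩
  have h := congrArg (MvPolynomial.coeff (f i)) hg
  rw [MvPolynomial.coeff_sum, Finset.sum_eq_single i] at h
  · rw [MvPolynomial.coeff_smul, (hP i).1] at h
    simp at h hi
    exact hi h
  · intro j _ hj
    rw [MvPolynomial.coeff_smul]
    by_cases hgj : g j = 0
    · simp [hgj]
    by_contra hc
    have h1 := (hP j).2 (f i) (right_ne_zero_of_mul hc)
    have h2 := hmax j (by simpa using hgj)
    rcases h1 with h1 | h1
    · exact hj (hf h1).symm
    · omega
  · simp

lemma finrank_linSys (n d s k mm e : ℕ) (hn : 1 ≤ n) (hm : 1 ≤ mm) (hdk : d = k + mm)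
    (hs : n + 3 + e ≤ s) (hnd : n * d = (n+2) * mm + e)
    (m : Fin s → ℕ) (hmc : ∀ i, m i = mm) (tp : Fin s → ℂ) (htp : Function.Injective tp) :
    Module.finrank ℂ (linSys n d s m tp) = (Adm k n d (k+1)).card := by
  classical
  have hV : ∀ P ∈ linSys n d s m tp, ∀ i, Van mm (tp i) P := by
    intro P hP i D hD
    exact ((mem_linSys_iff n d s m tp P).mp hP).2 i D (by rwa [hmc])
  -- upper bound
  let T : linSys n d s m tp →ₗ[ℂ] ({x // x ∈ Adm k n d (k+1)} → ℂ) :=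
    LinearMap.pi (fun x => (MvPolynomial.lcoeff ℂ (Finsupp.equivFunOnFinite.symm x.1)).comp
      (linSys n d s m tp).subtype)
  have hT : Function.Injective T := by
    rw [← LinearMap.ker_eq_bot, LinearMap.ker_eq_bot']
    rintro ⟨P, hP⟩ hz
    have hhom := ((mem_linSys_iff n d s m tp P).mp hP).1
    have : P = 0 := by
      refine upper_inj (k := k) (mm := mm) hn hm hdk P hhom ?_ ?_
      · intro D hD
        exact bezout n d s mm e hs hnd tp htp P hhom (hV P hP) (mm - 1) (by omega) D []
          List.nodup_nil (by simp) (by simp [hD])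
      · intro a ha
        have h := congrFun hz ⟨(a : Fin (n+1) → ℕ), ha⟩
        have e : Finsupp.equivFunOnFinite.symm (a : Fin (n+1) → ℕ) = a := by ext; simp
        simpa [T, e] using h
    ext1; exact this
  have : FiniteDimensional ℂ (linSys n d s m tp) := FiniteDimensional.of_injective T hT
  apply le_antisymm
  · have := LinearMap.finrank_le_finrank_of_injective hT
    simpa using this
  · let f : {x // x ∈ Adm k n d (k+1)} → (Fin (n+1) →₀ ℕ) :=
      fun x => Finsupp.equivFunOnFinite.symm x.1
    have hfinj : Function.Injective f := by
      intro x y h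
      exact Subtype.ext (Finsupp.equivFunOnFinite.symm.injective h)
    have hex : ∀ x : {x // x ∈ Adm k n d (k+1)}, ∃ P : MvPolynomial (Fin (n+1)) ℂ,
        P ∈ linSys n d s m tp ∧ Lead P (f x) := by
      intro x
      have hx := (mem_Adm _ _ _ _ _).mp x.2
      obtain ⟨P, h1, h2, h3⟩ := lower_exists hn k (f x) (by simpa [f] using hx.2.1)
      have hdeg : ldeg (f x) = d := by rw [← hx.1]; simp [ldeg, lw, f]
      rw [hdeg] at h1 h2
      refine ⟨P, (mem_linSys_iff n d s m tp P).mpr ⟨h1, ?_⟩, h3⟩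
      intro i D hD
      refine Van_of_mem (h2 (tp i)) D ?_
      rw [hmc] at hD; omega
    choose P hP1 hP2 using hex
    have hli : LinearIndependent ℂ (fun x => (⟨P x, hP1 x⟩ : linSys n d s m tp)) := by
      apply LinearIndependent.of_comp (linSys n d s m tp).subtype
      exact lead_indep f hfinj P hP2
    have := hli.fintype_card_le_finrank
    simpa using this

/-- **The homogeneous case (Proposition D).** If `m_1 = ⋯ = m_s = m ≥ 1`,
`L = L_{n,d}(m,…,m)` is effective with `s ≥ n+3` points on a rational normal curve,
and `k_C = m`, then `dim L = Σ (−1)^{|I|} F_t(n + k_{I,t} − r_{I,t} − 1, s, ε, n)`. -/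
theorem stmt_4 (n d s : ℕ) (hn : 2 ≤ n) (hs : n + 3 ≤ s)
    (mm : ℕ) (hm : 1 ≤ mm) (m : Fin s → ℕ) (hmconst : ∀ i, m i = mm)
    (tp : Fin s → ℂ) (htp : Function.Injective tp)
    (heff : linSys n d s m tp ≠ ⊥)
    (hkc : kC n d s m = (mm : ℤ))
    (ε : ℕ) (hε : (ε : ℤ) ≤ (s : ℤ) - n - 3)
    (hεdef : ((s : ℤ) - n - 2) * kC n d s m = (∑ i, (m i : ℤ)) - (n : ℤ) * d + ε) :
    (Module.finrank ℂ (linSys n d s m tp) : ℤ) =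
      ∑ t ∈ (Finset.range (n+1)).filter (fun t => 2 * t ≤ n),
        ∑ I ∈ Finset.univ.filter (fun I : Finset (Fin s) => I.card + 2 * t ≤ n),
          (-1 : ℤ) ^ I.card *
            Fb t ((n : ℤ) +
                ((∑ i ∈ I, (m i : ℤ)) + (t : ℤ) * kC n d s m
                  - ((t : ℤ) + I.card - 1) * d)
                - ((I.card : ℤ) + 2 * t - 1) - 1)
              s ε n := by
  classical
  have hsum : (∑ i, (m i : ℤ)) = s * mm := by simp [hmconst]
  have hmul : n * d = (n+2) * mm + ε := by
    rw [hkc, hsum] at hεdef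
    zify
    linarith
  have hdm : mm ≤ d := by nlinarith
  obtain ⟨k, hk⟩ : ∃ k, d = k + mm := ⟨d - mm, by omega⟩
  have hsz : n + 3 + ε ≤ s := by zify; linarith
  have h2d : 2 * d + ε = (n + 2) * k := by
    zify at hmul hk ⊢
    have : (k : ℤ) = d - mm := by linarith
    rw [this]; linarith
  have hfr := finrank_linSys n d s k mm ε (by omega) hm hk hsz hmul m hmconst tp htp
  rw [card_Adm k n d (k+1) le_rfl] at hfr
  have hne : Acnt k n d (k+1) ≠ 0 := by
    intro h0
    rw [h0] at hfr
    have hfd : (Adm k n d (k+1)).card = 0 := by rw [card_Adm k n d (k+1) le_rfl, h0]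
    apply heff
    rw [Submodule.eq_bot_iff]
    intro P hP
    have hhom := ((mem_linSys_iff n d s m tp P).mp hP).1
    have hV : ∀ i, Van mm (tp i) P := by
      intro i D hD
      exact ((mem_linSys_iff n d s m tp P).mp hP).2 i D (by rwa [hmconst])
    refine upper_inj (k := k) (mm := mm) (by omega) hm hk P hhom ?_ ?_
    · intro D hD
      exact bezout n d s mm ε hsz hmul tp htp P hhom hV (mm - 1) (by omega) D []
        List.nodup_nil (by simp) (by simp [hD])
    · intro a ha
      rw [Finset.card_eq_zero] at hfd
      rw [hfd] at ha
      simp at ha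
  have hodd := (Acnt_bound k n d (k+1) le_rfl hne).2
  obtain ⟨vq, hvq⟩ : ∃ vq : PowerSeries ℤ, (1 - PowerSeries.X ^ (k+2)) * vq = 1 := by
    have hu : IsUnit (1 - PowerSeries.X ^ (k+2) : PowerSeries ℤ) := by
      rw [PowerSeries.isUnit_iff_constantCoeff]; simp
    exact hu.exists_right_inv
  have hA := Acnt_formula k vxA vq vxA_mul hvq n d (k+1) (1+ε) le_rfl (by
    have : (n+1) * k + (k + 1) = (n+2) * k + 1 := by ring
    omega)
  have hC := comb_identity n d s k ε hsz h2d hodd vq hvq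
  rw [hfr, hA]
  have hpow : (1 - PowerSeries.X ^ (k+1) : PowerSeries ℤ) * (1 - PowerSeries.X ^ (k+1)) ^ (n+1+(1+ε))
      = (1 - PowerSeries.X ^ (k+1)) ^ (n+3+ε) := by
    rw [← pow_succ']; congr 1; ring
  rw [hpow, ← hC]
  apply Finset.sum_congr rfl
  intro t _
  have harg : ∀ I : Finset (Fin s), (-1 : ℤ) ^ I.card *
            Fb t ((n : ℤ) +
                ((∑ i ∈ I, (m i : ℤ)) + (t : ℤ) * kC n d s m
                  - ((t : ℤ) + I.card - 1) * d)
                - ((I.card : ℤ) + 2 * t - 1) - 1)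
              s ε n = (-1 : ℤ) ^ I.card * 
              Fb t ((n:ℤ) + ((d:ℤ) - (I.card : ℕ) * (k+1) - t * (k+2))) s ε n := by
    intro I
    congr 2
    have : (∑ i ∈ I, (m i : ℤ)) = I.card * mm := by simp [hmconst]
    rw [this, hkc, hk]
    push_cast
    ring
  simp only [harg]
  symm
  rw [← Finset.sum_fiberwise_of_maps_to (s := Finset.univ.filter
    (fun I : Finset (Fin s) => I.card + 2 * t ≤ n)) 
    (t := (Finset.range (n+1)).filter (fun i => i + 2 * t ≤ n)) (g := Finset.card)]
  · apply Finset.sum_congr rfl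
    intro i hi
    have hi' : i + 2 * t ≤ n := (Finset.mem_filter.mp hi).2
    have hfil : (Finset.univ.filter (fun I : Finset (Fin s) => I.card + 2 * t ≤ n)).filter
        (fun I => I.card = i) = Finset.powersetCard i Finset.univ := by
      ext I
      simp only [Finset.mem_filter, Finset.mem_univ, true_and, Finset.mem_powersetCard,
        Finset.subset_univ]
      constructor
      · exact fun h => h.2
      · intro h; exact ⟨by omega, h⟩
    rw [hfil, Finset.sum_congr rfl (g := fun _ => (-1 : ℤ) ^ i * 
              Fb t ((n:ℤ) + ((d:ℤ) - (i : ℕ) * (k+1) - t * (k+2))) s ε n)]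
    · rw [Finset.sum_const, Finset.card_powersetCard, Finset.card_univ, Fintype.card_fin,
        nsmul_eq_mul]
      ring
    · intro I hI
      rw [(Finset.mem_powersetCard.mp hI).2]
  · intro I hI
    have := (Finset.mem_filter.mp hI).2
    simp only [Finset.mem_filter, Finset.mem_range]
    omega

end
end

section
/- Let n ≥ 2, s ≥ n+3, suppose m_1 = ⋯ = m_s = 2 and that L = L_{n,d}(2,…,2) is nonzero (effective). Set vdim := C(n+d, n) − s·(n+1). Then: (i) if nd ≥ 2s − 1, then dim L = max(vdim, 0); (ii) if s+n+2 ≤ nd ≤ 2s − 2, then dim L = vdim + (2s − nd − 1); (iii) if nd ≤ s+n+1, then dim L = vdim + s(n+1) − n²(d−1) − 2. -/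
open Finset

noncomputable section

namespace RNC

open Polynomial

theorem finrank_comap_eq {M N : Type*} [AddCommGroup M] [Module ℂ M] [AddCommGroup N] [Module ℂ N]
    [FiniteDimensional ℂ M] (f : M →ₗ[ℂ] N) (R : Submodule ℂ N) (hR : R ≤ LinearMap.range f) :
    Module.finrank ℂ (R.comap f) = Module.finrank ℂ (LinearMap.ker f) + Module.finrank ℂ R := by
  have h := LinearMap.finrank_range_add_finrank_ker (f.domRestrict (R.comap f))
  have h1 : LinearMap.range (f.domRestrict (R.comap f)) = R := by
    rw [LinearMap.range_domRestrict, Submodule.map_comap_eq, inf_eq_right.mpr hR]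
  have h2 : Module.finrank ℂ (LinearMap.ker (f.domRestrict (R.comap f)))
      = Module.finrank ℂ (LinearMap.ker f) := by
    rw [LinearMap.ker_domRestrict]
    apply LinearEquiv.finrank_eq
    apply Submodule.comapSubtypeEquivOfLe
    intro x hx
    simp only [LinearMap.mem_ker] at hx
    simp [hx]
  rw [h1, h2] at h
  omega

theorem finrank_hom (n d : ℕ) :
    Module.finrank ℂ (MvPolynomial.homogeneousSubmodule (Fin (n+1)) ℂ d) = (n + d).choose n := by
  rw [MvPolynomial.homogeneousSubmodule_eq_finsupp_supported]
  rw [(AddMonoidAlgebra.supportedEquivFinsupp (S := ℂ) (R := ℂ) {x : Fin (n+1) →₀ ℕ | x.degree = d}).finrank_eq]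
  have e : {x : Fin (n+1) →₀ ℕ | x.degree = d} ≃ Sym (Fin (n+1)) d :=
    (Equiv.subtypeEquivRight (fun x => by
      simp [Finsupp.degree_eq_sum, Finsupp.sum_fintype])).trans (Sym.equivNatSum (Fin (n+1)) d).symm
  have : Fintype {x : Fin (n+1) →₀ ℕ | x.degree = d} := Fintype.ofEquiv _ e.symm
  rw [Module.finrank_finsupp_self, Fintype.card_congr e, Sym.card_sym_fin_eq_multichoose,
    Nat.multichoose_eq]
  have : n + 1 + d - 1 = n + d := by omega
  rw [this, ← Nat.choose_symm_add]

/-- gradient along the curve -/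
def Phi (n : ℕ) : MvPolynomial (Fin (n+1)) ℂ →ₗ[ℂ] (Fin (n+1) → ℂ[X]) :=
  LinearMap.pi fun j => (MvPolynomial.aeval (fun k : Fin (n+1) => (X : ℂ[X]) ^ (k:ℕ))).toLinearMap.comp
    (MvPolynomial.pderiv j).toLinearMap

theorem Phi_apply (n : ℕ) (P : MvPolynomial (Fin (n+1)) ℂ) (j : Fin (n+1)) :
    Phi n P j = MvPolynomial.aeval (fun k : Fin (n+1) => (X : ℂ[X]) ^ (k:ℕ)) (MvPolynomial.pderiv j P) := rfl

def Fsum (n : ℕ) : (Fin (n+1) → ℂ[X]) →ₗ[ℂ] ℂ[X] :=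
  ∑ j : Fin (n+1), (LinearMap.mulLeft ℂ ((X : ℂ[X]) ^ (j:ℕ))).comp (LinearMap.proj j)

def Gsum (n : ℕ) : (Fin (n+1) → ℂ[X]) →ₗ[ℂ] ℂ[X] :=
  ∑ j : Fin (n+1), (LinearMap.mulLeft ℂ ((j:ℂ[X]) * (X : ℂ[X]) ^ ((j:ℕ)-1))).comp (LinearMap.proj j)

theorem Fsum_apply (n : ℕ) (g : Fin (n+1) → ℂ[X]) : Fsum n g = ∑ j : Fin (n+1), X ^ (j:ℕ) * g j := by
  simp [Fsum]

theorem Gsum_apply (n : ℕ) (g : Fin (n+1) → ℂ[X]) :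
    Gsum n g = ∑ j : Fin (n+1), (j:ℂ[X]) * X ^ ((j:ℕ)-1) * g j := by
  simp [Gsum, mul_assoc]

def Wsub (n d : ℕ) : Submodule ℂ (Fin (n+1) → ℂ[X]) :=
  Submodule.pi Set.univ (fun _ => degreeLT ℂ (n*(d-1)+1)) ⊓
    LinearMap.ker ((Polynomial.derivative (R := ℂ)).comp (Fsum n) - (d:ℂ) • Gsum n)

theorem mem_Wsub (n d : ℕ) (g : Fin (n+1) → ℂ[X]) : g ∈ Wsub n d ↔
    (∀ j, g j ∈ degreeLT ℂ (n*(d-1)+1)) ∧ derivative (Fsum n g) = (d:ℂ) • Gsum n g := by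
  simp [Wsub, Submodule.mem_pi, sub_eq_zero]

/-- weight of an exponent -/
def wt {n : ℕ} (a : Fin (n+1) →₀ ℕ) : ℕ := ∑ j : Fin (n+1), (j:ℕ) * a j

theorem wt_add {n : ℕ} (a b : Fin (n+1) →₀ ℕ) : wt (a+b) = wt a + wt b := by
  simp [wt, mul_add, Finset.sum_add_distrib]

theorem wt_single {n : ℕ} (j : Fin (n+1)) (k : ℕ) : wt (Finsupp.single j k) = j * k := by
  simp [wt, Finsupp.single_apply, Finset.sum_ite_eq]

theorem wt_le {n : ℕ} (a : Fin (n+1) →₀ ℕ) : wt a ≤ n * a.degree := by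
  rw [Finsupp.degree_eq_sum, wt, Finset.mul_sum]
  exact Finset.sum_le_sum fun j _ => Nat.mul_le_mul_right _ (by omega)

theorem exists_exp (n r v : ℕ) (h : v ≤ n * r) :
    ∃ a : Fin (n+1) →₀ ℕ, a.degree = r ∧ wt a = v := by
  induction r generalizing v with
  | zero => exact ⟨0, by simp, by simp at h; simp [wt, h]⟩
  | succ r ih =>
    have h' : v ≤ n * r + n := by rw [mul_add] at h; simpa using h
    obtain ⟨a, ha, hw⟩ := ih (v - min v n) (by
      rcases le_total v n with h1 | h1
      · simp [h1]
      · simp [h1]; omega)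
    refine ⟨a + Finsupp.single ⟨min v n, by omega⟩ 1, ?_, ?_⟩
    · simp [ha]
    · rw [wt_add, wt_single, hw]; simp

theorem aeval_mon {n : ℕ} (b : Fin (n+1) →₀ ℕ) (c : ℂ) :
    MvPolynomial.aeval (fun k : Fin (n+1) => (X : ℂ[X]) ^ (k:ℕ)) (MvPolynomial.monomial b c)
      = C c * X ^ (wt b) := by
  rw [MvPolynomial.aeval_monomial, Finsupp.prod_fintype _ _ (by simp)]
  simp [wt, ← pow_mul, Finset.prod_pow_eq_pow_sum]

theorem le_wt {n : ℕ} (a : Fin (n+1) →₀ ℕ) (j : Fin (n+1)) (h : a j ≠ 0) : 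
    (j:ℕ) ≤ wt a ∧ wt (a - Finsupp.single j 1) = wt a - j ∧ (a - Finsupp.single j 1).degree = a.degree - 1
    ∧ wt a - j ≤ n * (a.degree - 1) := by
  have h1 : a - Finsupp.single j 1 + Finsupp.single j 1 = a := by
    apply tsub_add_cancel_of_le
    rw [Finsupp.single_le_iff]; omega
  have h2 := congrArg wt h1
  have h3 := congrArg Finsupp.degree h1
  rw [wt_add, wt_single] at h2
  simp at h3
  have h4 := wt_le (a - Finsupp.single j 1)
  have h5 : (a - Finsupp.single j 1).degree = a.degree - 1 := by omega
  rw [h5] at h4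
  refine ⟨by omega, by omega, h5, by omega⟩

theorem Phi_mon {n : ℕ} (a : Fin (n+1) →₀ ℕ) (c : ℂ) (j : Fin (n+1)) :
    Phi n (MvPolynomial.monomial a c) j = C (c * a j) * X ^ (wt a - j) := by
  rw [Phi_apply, MvPolynomial.pderiv_monomial, aeval_mon]
  by_cases h : a j = 0
  · simp [h]
  · rw [(le_wt a j h).2.1]

theorem mon_mem_Wsub {n d : ℕ} (a : Fin (n+1) →₀ ℕ) (hd : a.degree = d) (c : ℂ) :
    Phi n (MvPolynomial.monomial a c) ∈ Wsub n d := by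
  rw [mem_Wsub]
  constructor
  · intro j
    rw [Phi_mon, mem_degreeLT]
    by_cases h : a j = 0
    · simp only [h, Nat.cast_zero, mul_zero, map_zero, zero_mul, degree_zero]
      exact WithBot.bot_lt_coe _
    · refine lt_of_le_of_lt (degree_C_mul_X_pow_le _ _) ?_
      have := (le_wt a j h).2.2.2
      rw [hd] at this
      exact_mod_cast Nat.lt_succ_of_le this
  · have hF : Fsum n (Phi n (MvPolynomial.monomial a c)) = C (c * d) * X ^ (wt a) := by
      have : ∀ j : Fin (n+1), X ^ (j:ℕ) * Phi n (MvPolynomial.monomial a c) j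
          = C (c * a j) * X ^ (wt a) := by
        intro j
        rw [Phi_mon]
        by_cases h : a j = 0
        · simp [h]
        · rw [← Nat.add_sub_of_le (le_wt a j h).1, pow_add]; simp; ring
      rw [Fsum_apply, Finset.sum_congr rfl (fun j _ => this j), ← Finset.sum_mul, ← map_sum,
        ← Finset.mul_sum, ← hd, Finsupp.degree_eq_sum]
      push_cast
      rfl
    have hG : Gsum n (Phi n (MvPolynomial.monomial a c)) = C (c * wt a) * X ^ (wt a - 1) := by
      have : ∀ j : Fin (n+1), (j:ℂ[X]) * X ^ ((j:ℕ)-1) * Phi n (MvPolynomial.monomial a c) j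
          = C (c * ((j * a j : ℕ):ℂ)) * X ^ (wt a - 1) := by
        intro j
        rw [Phi_mon]
        by_cases h : a j = 0
        · simp [h]
        · by_cases h0 : (j:ℕ) = 0
          · simp [h0]
          · have e : wt a - 1 = ((j:ℕ) - 1) + (wt a - j) := by
              have := (le_wt a j h).1
              omega
            rw [e, pow_add]; simp; ring
      rw [Gsum_apply, Finset.sum_congr rfl (fun j _ => this j), ← Finset.sum_mul, ← map_sum,
        ← Finset.mul_sum, wt]
      push_cast
      rfl
    rw [hF, hG]
    simp [smul_eq_C_mul, derivative_X_pow]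
    ring

end RNC
namespace RNC

open Polynomial

theorem Phi_map_le (n d : ℕ) :
    (MvPolynomial.homogeneousSubmodule (Fin (n+1)) ℂ d).map (Phi n) ≤ Wsub n d := by
  rw [Submodule.map_le_iff_le_comap]
  intro P hP
  rw [Submodule.mem_comap, P.as_sum, map_sum]
  refine Submodule.sum_mem _ fun a ha => ?_
  apply mon_mem_Wsub
  rw [MvPolynomial.mem_homogeneousSubmodule] at hP
  by_contra h
  exact (MvPolynomial.mem_support_iff.mp ha) (hP.coeff_eq_zero h)

/-- exponent vectors of degree d and weight w -/
def expSet (n d w : ℕ) : Set (Fin (n+1) → ℂ) :=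
  {v | ∃ a : Fin (n+1) →₀ ℕ, a.degree = d ∧ wt a = w ∧ v = fun j => (a j : ℂ)}

theorem mem_span_exp (n d w : ℕ) (hn : 1 ≤ n) (hd : 3 ≤ d) (hw : w ≤ n * d) (b : Fin (n+1) → ℂ)
    (hb1 : ∀ j : Fin (n+1), w < j → b j = 0)
    (hb2 : ∀ j : Fin (n+1), n * (d-1) < w - j → b j = 0)
    (hb : (w:ℂ) * ∑ j, b j = d * ∑ j : Fin (n+1), (j:ℂ) * b j) :
    b ∈ Submodule.span ℂ (expSet n d w) := by
  by_contra hcon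
  obtain ⟨l, hl0, hl⟩ := Submodule.exists_le_ker_of_notMem hcon
  apply hl0
  set lam : Fin (n+1) → ℂ := fun j => l (Pi.single j 1) with hlam
  have hl1 : ∀ v : Fin (n+1) → ℂ, l v = ∑ j, v j * lam j := by
    intro v
    conv_lhs => rw [← Finset.univ_sum_single v]
    rw [map_sum]
    refine Finset.sum_congr rfl fun j _ => ?_
    have : (Pi.single j (v j) : Fin (n+1) → ℂ) = v j • Pi.single j 1 := by
      rw [← Pi.single_smul]; simp
    rw [this, map_smul, smul_eq_mul]
  have hexp : ∀ a : Fin (n+1) →₀ ℕ, a.degree = d → wt a = w → ∑ j, (a j : ℂ) * lam j = 0 := by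
    intro a h1 h2
    have := hl (Submodule.subset_span ⟨a, h1, h2, rfl⟩)
    rw [LinearMap.mem_ker, hl1] at this
    exact this
  have hd2 : n * (d - 1) = n * (d-2) + n := by
    obtain ⟨k, rfl⟩ := Nat.exists_eq_add_of_le hd
    have h1 : 3 + k - 1 = k + 2 := by omega
    have h2 : 3 + k - 2 = k + 1 := by omega
    rw [h1, h2]; ring
  have hd3 : n * d = n * (d-2) + 2 * n := by
    obtain ⟨k, rfl⟩ := Nat.exists_eq_add_of_le hd
    have h2 : 3 + k - 2 = k + 1 := by omega
    rw [h2]; ring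
  have hd4 : n ≤ n * (d-2) := Nat.le_mul_of_pos_right _ (by omega)
  -- the swap identity
  have swap : ∀ i j : ℕ, ∀ hi : i < n, ∀ hj : j < n, i + j + 1 ≤ w → w - (i + j + 1) ≤ n * (d-2) →
      lam ⟨i+1, by omega⟩ - lam ⟨i, by omega⟩ = lam ⟨j+1, by omega⟩ - lam ⟨j, by omega⟩ := by
    intro i j hi hj h1 h2
    obtain ⟨a, ha, haw⟩ := exists_exp n (d-2) _ h2
    have e1 := hexp (a + Finsupp.single ⟨i+1, by omega⟩ 1 + Finsupp.single ⟨j, by omega⟩ 1)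
      (by simp [ha]; omega) (by simp [wt_add, wt_single, haw]; omega)
    have e2 := hexp (a + Finsupp.single ⟨i, by omega⟩ 1 + Finsupp.single ⟨j+1, by omega⟩ 1)
      (by simp [ha]; omega) (by simp [wt_add, wt_single, haw]; omega)
    simp only [Finsupp.add_apply, Finsupp.single_apply, Nat.cast_add, add_mul, Finset.sum_add_distrib,
      Nat.cast_ite, Nat.cast_one, Nat.cast_zero, ite_mul, one_mul, zero_mul, Finset.sum_ite_eq,
      Finset.mem_univ, if_true] at e1 e2
    linear_combination e1 - e2
  -- pivot
  set p := min (w - n) (n - 1) with hp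
  set δ : ℂ := lam ⟨p+1, by omega⟩ - lam ⟨p, by omega⟩ with hδ
  set lo := w - n * (d-1) with hlo
  have step : ∀ i : ℕ, ∀ hi : i < n, i < w → lo ≤ i →
      lam ⟨i+1, by omega⟩ - lam ⟨i, by omega⟩ = δ := by
    intro i hi hiw hlo'
    exact swap i p hi (by omega) (by omega) (by omega)
  have hlon : lo ≤ n := by omega
  have aff : ∀ k : ℕ, ∀ hk : lo + k ≤ n, lo + k ≤ w →
      lam ⟨lo + k, by omega⟩ = lam ⟨lo, by omega⟩ + k * δ := by
    intro k
    induction k with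
    | zero => intro _ _; simp
    | succ k ih =>
      intro h1 h2
      have e1 := ih (by omega) (by omega)
      have e2 := step (lo + k) (by omega) (by omega) (by omega)
      have : lam ⟨lo + (k+1), by omega⟩ = lam ⟨lo + k + 1, by omega⟩ := rfl
      rw [this]
      push_cast
      linear_combination e1 + e2
  set α : ℂ := lam ⟨lo, by omega⟩ - lo * δ with hα
  have aff' : ∀ j : Fin (n+1), lo ≤ j → (j:ℕ) ≤ w → lam j = α + j * δ := by
    intro j h1 h2
    have := aff (j - lo) (by omega) (by omega)
    have e : (⟨lo + (j - lo), by omega⟩ : Fin (n+1)) = j := by ext; simp; omega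
    rw [e, Nat.cast_sub h1] at this
    rw [this, hα]; ring
  have key : ∀ v : Fin (n+1) → ℂ, (∀ j : Fin (n+1), w < j → v j = 0) →
      (∀ j : Fin (n+1), n * (d-1) < w - j → v j = 0) →
      l v = α * ∑ j, v j + δ * ∑ j : Fin (n+1), (j:ℂ) * v j := by
    intro v h1 h2
    rw [hl1, Finset.mul_sum, Finset.mul_sum, ← Finset.sum_add_distrib]
    refine Finset.sum_congr rfl fun j _ => ?_
    by_cases c1 : w < j
    · simp [h1 j c1]
    by_cases c2 : n * (d-1) < w - j
    · simp [h2 j c2]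
    rw [aff' j (by omega) (by omega)]; ring
  obtain ⟨a, ha, haw⟩ := exists_exp n d w hw
  have k1 := key (fun j => (a j : ℂ)) (by
    intro j hj
    by_contra h
    have := (le_wt a j (by simpa using h)).1
    omega) (by
    intro j hj
    by_contra h
    have := (le_wt a j (by simpa using h)).2.2.2
    rw [ha, haw] at this
    omega)
  have k2 := key b hb1 hb2
  rw [hl1, hexp a ha haw] at k1
  have s1 : ∑ j, (a j : ℂ) = d := by
    rw [← ha, Finsupp.degree_eq_sum]; push_cast; rfl
  have s2 : ∑ j : Fin (n+1), (j:ℂ) * (a j : ℂ) = w := by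
    rw [← haw, wt]; push_cast; rfl
  simp only [s1, s2] at k1
  have hd0 : (d:ℂ) ≠ 0 := by
    have : d ≠ 0 := by omega
    exact_mod_cast this
  have : (d:ℂ) * l b = 0 := by
    rw [k2]
    linear_combination (-δ) * hb - (∑ j, b j) * k1
  exact (mul_eq_zero.mp this).resolve_left hd0

/-- weight piece embedding -/
def iota (n w : ℕ) : (Fin (n+1) → ℂ) →ₗ[ℂ] (Fin (n+1) → ℂ[X]) :=
  LinearMap.pi fun j => (Polynomial.monomial (w - j)).comp (LinearMap.proj j)

theorem iota_span_le (n d w : ℕ) : (Submodule.span ℂ (expSet n d w)).map (iota n w) ≤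
    (MvPolynomial.homogeneousSubmodule (Fin (n+1)) ℂ d).map (Phi n) := by
  rw [Submodule.map_span, Submodule.span_le]
  rintro _ ⟨_, ⟨a, ha, haw, rfl⟩, rfl⟩
  refine ⟨MvPolynomial.monomial a 1, ?_, ?_⟩
  · exact MvPolynomial.isHomogeneous_monomial _ ha
  · funext j
    rw [Phi_mon, haw, one_mul, C_mul_X_pow_eq_monomial]
    rfl

theorem Phi_map_eq (n d : ℕ) (hn : 1 ≤ n) (hd : 3 ≤ d) :
    (MvPolynomial.homogeneousSubmodule (Fin (n+1)) ℂ d).map (Phi n) = Wsub n d := by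
  apply le_antisymm (Phi_map_le n d)
  intro g hg
  rw [mem_Wsub] at hg
  obtain ⟨hdeg, hder⟩ := hg
  have hd1 : n * d = n * (d-1) + n := by
    obtain ⟨k, rfl⟩ := Nat.exists_eq_add_of_le hd
    have h1 : 3 + k - 1 = k + 2 := by omega
    rw [h1]; ring
  have hc : ∀ j k, n * (d-1) < k → (g j).coeff k = 0 := by
    intro j k hk
    apply coeff_eq_zero_of_degree_lt
    refine lt_of_lt_of_le (mem_degreeLT.mp (hdeg j)) ?_
    exact_mod_cast hk
  set b : ℕ → Fin (n+1) → ℂ := fun w j => if (j:ℕ) ≤ w then (g j).coeff (w - j) else 0 with hbdef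
  have hg : g = ∑ w ∈ Finset.range (n * d + 1), iota n w (b w) := by
    funext j
    ext k
    rw [Finset.sum_apply, finsetSum_coeff]
    simp only [iota, LinearMap.pi_apply, LinearMap.comp_apply, LinearMap.proj_apply, coeff_monomial, hbdef]
    by_cases hk : n * (d-1) < k
    · rw [hc j k hk, Finset.sum_eq_zero]
      intro w _
      split_ifs with h1 h2
      · rw [h1, hc j k hk]
      · rfl
      · rfl
    · rw [Finset.sum_eq_single (k + j)]
      · simp
      · intro w _ hw
        split_ifs with h1 h2
        · omega
        · rfl
        · rfl
      · intro h
        exfalso; apply h; rw [Finset.mem_range]; omega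
  have hcond : ∀ w : ℕ, (w:ℂ) * ∑ j, b w j = d * ∑ j : Fin (n+1), (j:ℂ) * b w j := by
    intro w
    rcases Nat.eq_zero_or_pos w with rfl | hw
    · have : ∀ j : Fin (n+1), (j:ℂ) * b 0 j = 0 := by
        intro j
        by_cases h : (j:ℕ) = 0
        · simp [h]
        · simp [hbdef, h]
      simp [this]
    · obtain ⟨v, rfl⟩ := Nat.exists_eq_add_of_le' hw
      have h := congrArg (fun P => P.coeff v) hder
      simp only [coeff_derivative, coeff_smul, Fsum_apply, Gsum_apply, finsetSum_coeff, smul_eq_mul] at h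
      have h1 : ∀ j : Fin (n+1), (X ^ (j:ℕ) * g j).coeff (v+1) = b (v+1) j := by
        intro j
        rw [coeff_X_pow_mul']
      have h2 : ∀ j : Fin (n+1), ((j:ℂ[X]) * X ^ ((j:ℕ)-1) * g j).coeff v = j * b (v+1) j := by
        intro j
        by_cases h0 : (j:ℕ) = 0
        · simp [h0]
        · rw [mul_assoc, ← C_eq_natCast, coeff_C_mul, coeff_X_pow_mul']
          congr 1
          simp only [hbdef]
          by_cases h3 : (j:ℕ) ≤ v + 1
          · rw [if_pos h3, if_pos (by omega)]
            congr 1; omega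
          · rw [if_neg h3, if_neg (by omega)]
      simp only [h1, h2] at h
      push_cast
      rw [← h]; ring
  rw [hg]
  refine Submodule.sum_mem _ fun w hw => ?_
  apply iota_span_le n d w
  refine ⟨b w, ?_, rfl⟩
  apply mem_span_exp n d w hn hd (by rw [Finset.mem_range] at hw; omega)
  · intro j hj; simp only [hbdef]; rw [if_neg (by omega)]
  · intro j hj; simp only [hbdef]; rw [hc j _ hj]; simp
  · exact hcond w

end RNC
namespace RNC

open Polynomial

theorem mem_dLT {m : ℕ} {p : ℂ[X]} : p ∈ degreeLT ℂ m ↔ ∀ i, m ≤ i → p.coeff i = 0 := by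
  rw [mem_degreeLT, degree_lt_iff_coeff_zero]

theorem finrank_dLT (m : ℕ) : Module.finrank ℂ (degreeLT ℂ m) = m := by
  rw [(degreeLTEquiv ℂ m).finrank_eq]; simp

instance finite_dLT (m : ℕ) : Module.Finite ℂ (degreeLT ℂ m) :=
  Module.Finite.equiv (degreeLTEquiv ℂ m).symm

theorem dLT_of_mul {q p : ℂ[X]} {m : ℕ} (hq : q.Monic) (h : q * p ∈ degreeLT ℂ m) :
    p ∈ degreeLT ℂ (m - q.natDegree) := by
  by_cases hp : p = 0
  · subst hp; exact Submodule.zero_mem _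
  have h0 : q * p ≠ 0 := mul_ne_zero hq.ne_zero hp
  rw [mem_degreeLT, ← natDegree_lt_iff_degree_lt h0, natDegree_mul hq.ne_zero hp] at h
  rw [mem_degreeLT, ← natDegree_lt_iff_degree_lt hp]
  omega

theorem dLT_mul {q p : ℂ[X]} {m k : ℕ} (hp : p ∈ degreeLT ℂ m) (hk : m + q.natDegree ≤ k) :
    q * p ∈ degreeLT ℂ k := by
  by_cases h : q * p = 0
  · rw [h]; exact Submodule.zero_mem _
  have h2 : p ≠ 0 := right_ne_zero_of_mul h
  have h1 : q ≠ 0 := left_ne_zero_of_mul h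
  rw [mem_degreeLT, ← natDegree_lt_iff_degree_lt h2] at hp
  rw [mem_degreeLT, ← natDegree_lt_iff_degree_lt h, natDegree_mul h1 h2]
  omega

theorem dLT_zero {p : ℂ[X]} (h : p ∈ degreeLT ℂ 0) : p = 0 := by
  ext i
  rw [mem_dLT.mp h i (Nat.zero_le _), coeff_zero]

def inc (n e : ℕ) : (Fin (n+1) → degreeLT ℂ (e+1)) →ₗ[ℂ] (Fin (n+1) → ℂ[X]) :=
  (degreeLT ℂ (e+1)).subtype.compLeft (Fin (n+1))

theorem inc_apply (n e : ℕ) (h : Fin (n+1) → degreeLT ℂ (e+1)) (j : Fin (n+1)) :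
    inc n e h j = (h j : ℂ[X]) := rfl

def Bsum (n : ℕ) : (Fin (n+1) → ℂ[X]) →ₗ[ℂ] ℂ[X] :=
  (n:ℂ) • Fsum n - (LinearMap.mulLeft ℂ (X : ℂ[X])).comp (Gsum n)

theorem Bsum_def (n : ℕ) (g : Fin (n+1) → ℂ[X]) :
    Bsum n g = (n:ℂ) • Fsum n g - X * Gsum n g := rfl

theorem Bsum_apply (n : ℕ) (g : Fin (n+1) → ℂ[X]) :
    Bsum n g = ∑ j : Fin (n+1), ((n - (j:ℕ) : ℕ) : ℂ[X]) * X ^ (j:ℕ) * g j := by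
  rw [Bsum_def, Fsum_apply, Gsum_apply, Finset.smul_sum, Finset.mul_sum, ← Finset.sum_sub_distrib]
  refine Finset.sum_congr rfl fun j _ => ?_
  rw [Nat.cast_sub (by omega), smul_eq_C_mul, C_eq_natCast]
  by_cases h0 : (j:ℕ) = 0
  · simp [h0]
  · obtain ⟨k, hk⟩ := Nat.exists_eq_succ_of_ne_zero h0
    rw [hk]; simp only [Nat.succ_eq_add_one, Nat.add_sub_cancel, pow_succ]; ring

def TT (n e : ℕ) : (Fin (n+1) → degreeLT ℂ (e+1)) →ₗ[ℂ] ℂ[X] × ℂ[X] :=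
  ((Gsum n).comp (inc n e)).prod ((Bsum n).comp (inc n e))

theorem TT_apply (n e : ℕ) (h : Fin (n+1) → degreeLT ℂ (e+1)) :
    TT n e h = (Gsum n (inc n e h), Bsum n (inc n e h)) := rfl

theorem TT_single (n e j k : ℕ) (hj : j ≤ n) (hk : k ≤ e) :
    ((j:ℂ) • (X:ℂ[X]) ^ (j - 1 + k), ((n:ℂ) - j) • (X:ℂ[X]) ^ (j + k)) ∈ LinearMap.range (TT n e) := by
  have hX : (X:ℂ[X]) ^ k ∈ degreeLT ℂ (e+1) := by
    rw [mem_degreeLT, degree_X_pow]; exact_mod_cast Nat.lt_succ_of_le hk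
  refine ⟨Pi.single ⟨j, by omega⟩ ⟨X ^ k, hX⟩, ?_⟩
  have hi : ∀ i : Fin (n+1), inc n e (Pi.single ⟨j, by omega⟩ ⟨X ^ k, hX⟩) i
      = if i = ⟨j, by omega⟩ then X ^ k else 0 := by
    intro i
    rw [inc_apply, Pi.single_apply]
    split_ifs <;> rfl
  rw [TT_apply, Gsum_apply, Bsum_apply]
  simp only [hi, mul_ite, mul_zero, Finset.sum_ite_eq', Finset.mem_univ, if_true]
  rw [Nat.cast_sub hj, smul_eq_C_mul, smul_eq_C_mul]
  simp [pow_add, mul_assoc]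

theorem TT_pair (n e w : ℕ) (hn : 1 ≤ n) (he : 1 ≤ e) (h1 : 1 ≤ w) (h2 : w + 1 ≤ e + n) :
    ((X:ℂ[X]) ^ (w-1), (0:ℂ[X])) ∈ LinearMap.range (TT n e) ∧
    ((0:ℂ[X]), (X:ℂ[X]) ^ w) ∈ LinearMap.range (TT n e) := by
  obtain ⟨j, hj⟩ : ∃ j, j = w - e := ⟨_, rfl⟩
  have m1 := TT_single n e j (w - j) (by omega) (by omega)
  have m2 := TT_single n e (j+1) (w - (j+1)) (by omega) (by omega)
  have hn0 : (n:ℂ) ≠ 0 := by exact_mod_cast (by omega : n ≠ 0)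
  have e2 : j + 1 + (w - (j+1)) = w := by omega
  have e1 : j + (w - j) = w := by omega
  have e4 : j + 1 - 1 + (w - (j+1)) = w - 1 := by omega
  rw [e1] at m1
  rw [e2, e4] at m2
  have m1' : ((j:ℂ) • (X:ℂ[X]) ^ (w - 1), ((n:ℂ) - j) • (X:ℂ[X]) ^ w) ∈ LinearMap.range (TT n e) := by
    by_cases h0 : j = 0
    · simpa [h0] using m1
    · have e3 : j - 1 + (w - j) = w - 1 := by omega
      rwa [e3] at m1
  constructor
  · have := Submodule.smul_mem _ (n:ℂ)⁻¹ (Submodule.sub_mem _ (Submodule.smul_mem _ ((n:ℂ) - j) m2)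
      (Submodule.smul_mem _ ((n:ℂ) - (j+1)) m1'))
    convert this using 1
    ext1
    · simp only [Prod.smul_mk, Prod.mk_sub_mk, smul_smul, ← sub_smul]
      conv_lhs => rw [← one_smul ℂ ((X:ℂ[X])^(w-1))]
      congr 1; push_cast; field_simp; ring
    · simp only [Prod.smul_mk, Prod.mk_sub_mk, smul_smul, ← sub_smul]
      conv_lhs => rw [← zero_smul ℂ ((X:ℂ[X])^w)]
      congr 1; push_cast; ring
  · have := Submodule.smul_mem _ (n:ℂ)⁻¹ (Submodule.sub_mem _ (Submodule.smul_mem _ ((j:ℂ)+1) m1')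
      (Submodule.smul_mem _ (j:ℂ) m2))
    convert this using 1
    ext1
    · simp only [Prod.smul_mk, Prod.mk_sub_mk, smul_smul, ← sub_smul]
      conv_lhs => rw [← zero_smul ℂ ((X:ℂ[X])^(w-1))]
      congr 1; push_cast; ring
    · simp only [Prod.smul_mk, Prod.mk_sub_mk, smul_smul, ← sub_smul]
      conv_lhs => rw [← one_smul ℂ ((X:ℂ[X])^w)]
      congr 1; push_cast; field_simp; ring

theorem range_TT (n e : ℕ) (hn : 1 ≤ n) (he : 1 ≤ e) :
    LinearMap.range (TT n e) = (degreeLT ℂ (e+n)).prod (degreeLT ℂ (e+n)) := by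
  classical
  have hn0 : (n:ℂ) ≠ 0 := by exact_mod_cast (by omega : n ≠ 0)
  apply le_antisymm
  · rintro _ ⟨h, rfl⟩
    rw [TT_apply, Submodule.mem_prod]
    constructor
    · show Gsum n _ ∈ _
      rw [Gsum_apply]
      refine Submodule.sum_mem _ fun j _ => ?_
      by_cases h0 : (j:ℕ) = 0
      · simp [h0]
      · apply dLT_mul (h j).2
        have : ((j:ℂ[X]) * X ^ ((j:ℕ) - 1)).natDegree ≤ (j:ℕ) - 1 := by
          rw [← C_eq_natCast]; exact natDegree_C_mul_X_pow_le _ _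
        omega
    · show Bsum n _ ∈ _
      rw [Bsum_apply]
      refine Submodule.sum_mem _ fun j _ => ?_
      by_cases h0 : (j:ℕ) = n
      · simp [h0]
      · apply dLT_mul (h j).2
        have : (((n - (j:ℕ) : ℕ):ℂ[X]) * X ^ (j:ℕ)).natDegree ≤ (j:ℕ) := by
          rw [← C_eq_natCast]; exact natDegree_C_mul_X_pow_le _ _
        omega
  · have hA : (degreeLT ℂ (e+n)).map (LinearMap.inl ℂ ℂ[X] ℂ[X]) ≤ LinearMap.range (TT n e) := by
      rw [degreeLT_eq_span_X_pow, Submodule.map_span, Submodule.span_le]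
      rintro _ ⟨p, hp, rfl⟩
      simp only [Finset.coe_image, Set.mem_image, Finset.mem_coe, Finset.mem_range] at hp
      obtain ⟨v, hv, rfl⟩ := hp
      by_cases h : v + 1 + 1 ≤ e + n
      · have := (TT_pair n e (v+1) hn he (by omega) h).1
        simpa using this
      · have := Submodule.smul_mem _ (n:ℂ)⁻¹ (TT_single n e n e le_rfl le_rfl)
        have e1 : n - 1 + e = v := by omega
        rw [e1] at this
        simpa [smul_smul, hn0] using this
    have hB : (degreeLT ℂ (e+n)).map (LinearMap.inr ℂ ℂ[X] ℂ[X]) ≤ LinearMap.range (TT n e) := by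
      rw [degreeLT_eq_span_X_pow, Submodule.map_span, Submodule.span_le]
      rintro _ ⟨p, hp, rfl⟩
      simp only [Finset.coe_image, Set.mem_image, Finset.mem_coe, Finset.mem_range] at hp
      obtain ⟨v, hv, rfl⟩ := hp
      by_cases h : 1 ≤ v
      · have := (TT_pair n e v hn he h (by omega)).2
        simpa using this
      · have h0 : v = 0 := by omega
        subst h0
        have := Submodule.smul_mem _ (n:ℂ)⁻¹ (TT_single n e 0 0 (Nat.zero_le _) (Nat.zero_le _))
        simpa [smul_smul, hn0] using this
    rintro ⟨A, B⟩ ⟨h1, h2⟩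
    have e1 : (A, B) = LinearMap.inl ℂ ℂ[X] ℂ[X] A + LinearMap.inr ℂ ℂ[X] ℂ[X] B := by simp
    rw [e1]
    exact Submodule.add_mem _ (hA ⟨A, h1, rfl⟩) (hB ⟨B, h2, rfl⟩)

theorem finrank_ker_TT (n e : ℕ) (hn : 1 ≤ n) (he : 1 ≤ e) :
    Module.finrank ℂ (LinearMap.ker (TT n e)) + 2 * (e + n) = (n+1) * (e+1) := by
  have h := LinearMap.finrank_range_add_finrank_ker (TT n e)
  have h2 : Module.finrank ℂ (LinearMap.range (TT n e)) = 2 * (e + n) := by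
    have hr : LinearMap.range (TT n e)
        = LinearMap.range ((degreeLT ℂ (e+n)).subtype.prodMap (degreeLT ℂ (e+n)).subtype) := by
      rw [range_TT n e hn he, LinearMap.range_prodMap, Submodule.range_subtype]
    rw [hr, LinearMap.finrank_range_of_inj, Module.finrank_prod, finrank_dLT]
    · ring
    · rw [LinearMap.coe_prodMap]
      exact Function.Injective.prodMap (Submodule.injective_subtype _) (Submodule.injective_subtype _)
  have h3 : Module.finrank ℂ (Fin (n+1) → degreeLT ℂ (e+1)) = (n+1)*(e+1) := by
    rw [Module.finrank_pi_fintype]; simp [finrank_dLT]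
  omega

end RNC
namespace RNC

open Polynomial

/-- tuples divisible by `q` -/
def Vq (n : ℕ) (q : ℂ[X]) : Submodule ℂ (Fin (n+1) → ℂ[X]) where
  carrier := {g | ∀ j, q ∣ g j}
  add_mem' := fun ha hb j => dvd_add (ha j) (hb j)
  zero_mem' := fun _ => dvd_zero _
  smul_mem' := fun c g hg j => by
    show q ∣ c • g j
    rw [smul_eq_C_mul]; exact (hg j).mul_left _

theorem mem_Vq {n : ℕ} {q : ℂ[X]} {g : Fin (n+1) → ℂ[X]} : g ∈ Vq n q ↔ ∀ j, q ∣ g j := Iff.rfl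

def RR (n d m : ℕ) (q : ℂ[X]) : Submodule ℂ (ℂ[X] × ℂ[X]) where
  carrier := {x | x.1 ∈ degreeLT ℂ m ∧ x.2 ∈ degreeLT ℂ m ∧
    derivative (q * (x.2 + X * x.1)) = ((n:ℂ[X]) * (d:ℂ[X])) * (q * x.1)}
  add_mem' := by
    rintro ⟨A, B⟩ ⟨A', B'⟩ ⟨h1, h2, h3⟩ ⟨h1', h2', h3'⟩
    refine ⟨Submodule.add_mem _ h1 h1', Submodule.add_mem _ h2 h2', ?_⟩
    have : q * ((B + B') + X * (A + A')) = q * (B + X * A) + q * (B' + X * A') := by ring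
    simp only [Prod.mk_add_mk, this, map_add] at h3 h3' ⊢
    rw [h3, h3']; ring
  zero_mem' := ⟨Submodule.zero_mem _, Submodule.zero_mem _, by simp⟩
  smul_mem' := by
    rintro c ⟨A, B⟩ ⟨h1, h2, h3⟩
    refine ⟨Submodule.smul_mem _ _ h1, Submodule.smul_mem _ _ h2, ?_⟩
    have : q * (c • B + X * (c • A)) = c • (q * (B + X * A)) := by
      simp only [smul_eq_C_mul]; ring
    simp only [Prod.smul_mk, this, derivative_smul] at h3 ⊢
    rw [h3]; simp only [smul_eq_C_mul]; ring

theorem mem_RR {n d m : ℕ} {q A B : ℂ[X]} : (A, B) ∈ RR n d m q ↔ A ∈ degreeLT ℂ m ∧ B ∈ degreeLT ℂ m ∧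
    derivative (q * (B + X * A)) = ((n:ℂ[X]) * (d:ℂ[X])) * (q * A) := Iff.rfl

def J1 (d : ℕ) (q : ℂ[X]) : ℂ[X] →ₗ[ℂ] ℂ[X] :=
  (d:ℂ)⁻¹ • ((LinearMap.mulLeft ℂ (2 * derivative q)) + (LinearMap.mulLeft ℂ q).comp derivative)

def JJ (n d : ℕ) (q : ℂ[X]) : ℂ[X] →ₗ[ℂ] ℂ[X] × ℂ[X] :=
  (J1 d q).prod ((n:ℂ) • LinearMap.mulLeft ℂ q - (LinearMap.mulLeft ℂ (X:ℂ[X])).comp (J1 d q))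

theorem JJ_apply (n d : ℕ) (q k : ℂ[X]) :
    JJ n d q k = (J1 d q k, (n:ℂ) • (q * k) - X * J1 d q k) := rfl

theorem J1_mul (d : ℕ) (hd : 1 ≤ d) (q k : ℂ[X]) :
    (d:ℂ[X]) * (q * J1 d q k) = derivative (q * (q * k)) := by
  have hd0 : (d:ℂ) ≠ 0 := by exact_mod_cast (by omega : d ≠ 0)
  have : (d:ℂ[X]) * C ((d:ℂ)⁻¹) = 1 := by
    rw [← C_eq_natCast, ← C_mul, mul_inv_cancel₀ hd0, C_1]
  simp only [J1, LinearMap.smul_apply, LinearMap.add_apply, LinearMap.mulLeft_apply,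
    LinearMap.comp_apply, smul_eq_C_mul, derivative_mul]
  linear_combination (q * (2 * derivative q * k + q * derivative k)) * this

theorem RR_eq (n d s e : ℕ) (hn : 1 ≤ n) (hd : 1 ≤ d) (q : ℂ[X]) (hq : q.Monic)
    (hs : q.natDegree = s) (hcop : IsCoprime q (derivative q)) (hes : e + n + s = n * d) :
    RR n d (e+n) q = (degreeLT ℂ (n*d+1-2*s)).map (JJ n d q) := by
  have hn0 : (n:ℂ) ≠ 0 := by exact_mod_cast (by omega : n ≠ 0)
  have hd0 : (d:ℂ) ≠ 0 := by exact_mod_cast (by omega : d ≠ 0)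
  have hnC : (n:ℂ[X]) ≠ 0 := by exact_mod_cast (by omega : n ≠ 0)
  have hdC : (d:ℂ[X]) ≠ 0 := by exact_mod_cast (by omega : d ≠ 0)
  have hq0 := hq.ne_zero
  apply le_antisymm
  · rintro ⟨A, B⟩ hAB
    rw [mem_RR] at hAB
    obtain ⟨hA, hB, h⟩ := hAB
    have hdvd : q ∣ B + X * A := by
      have h1 : q ∣ (B + X * A) * derivative q := by
        rw [derivative_mul] at h
        exact ⟨((n:ℂ[X]) * (d:ℂ[X])) * A - derivative (B + X * A), by linear_combination h⟩
      exact hcop.dvd_of_dvd_mul_right h1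
    obtain ⟨k', hk'⟩ := hdvd
    have hk : ∃ k, k' = (n:ℂ[X]) * k := ⟨C ((n:ℂ)⁻¹) * k', by
      rw [← mul_assoc, ← C_eq_natCast, ← C_mul, mul_inv_cancel₀ hn0, C_1, one_mul]⟩
    obtain ⟨k, rfl⟩ := hk
    have hJ := J1_mul d hd q k
    have hA1 : A = J1 d q k := by
      rw [hk'] at h
      have e1 : q * (q * ((n:ℂ[X]) * k)) = C (n:ℂ) * (q * (q * k)) := by
        rw [C_eq_natCast]; ring
      rw [e1, derivative_C_mul, ← hJ, C_eq_natCast] at h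
      have : ((n:ℂ[X]) * (d:ℂ[X]) * q) * A = ((n:ℂ[X]) * (d:ℂ[X]) * q) * J1 d q k := by linear_combination -h
      exact mul_left_cancel₀ (mul_ne_zero (mul_ne_zero hnC hdC) hq0) this
    refine ⟨k, ?_, ?_⟩
    · have h1 : B + X * A ∈ degreeLT ℂ (e + n + 1) :=
        Submodule.add_mem _ (degreeLT_mono (by omega) hB) (dLT_mul hA (by simp))
      have h2 : q * k ∈ degreeLT ℂ (e + n + 1) := by
        have : q * k = (n:ℂ)⁻¹ • (B + X * A) := by
          rw [hk', smul_eq_C_mul]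
          have : C ((n:ℂ)⁻¹) * (n:ℂ[X]) = 1 := by
            rw [← C_eq_natCast, ← C_mul, inv_mul_cancel₀ hn0, C_1]
          linear_combination (-(q * k)) * this
        rw [this]; exact Submodule.smul_mem _ _ h1
      have h3 := dLT_of_mul hq h2
      rw [hs] at h3
      have : n * d + 1 - 2 * s = e + n + 1 - s := by omega
      show k ∈ degreeLT ℂ _
      rw [this]; exact h3
    · rw [JJ_apply, ← hA1]
      congr 1
      rw [smul_eq_C_mul, C_eq_natCast]
      linear_combination -hk'
  · rintro _ ⟨k, hk, rfl⟩
    rw [JJ_apply, mem_RR]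
    have hk : k ∈ degreeLT ℂ (n*d+1-2*s) := hk
    have hJ := J1_mul d hd q k
    have hf : q * (q * k) ∈ degreeLT ℂ (n * d + 1) := by
      by_cases h2 : 2 * s ≤ n * d + 1
      · exact dLT_mul (dLT_mul hk le_rfl) (by omega)
      · rw [show n * d + 1 - 2 * s = 0 by omega] at hk
        rw [dLT_zero hk]; simp
    set f := q * (q * k) with hfdef
    have hdd : (d:ℂ[X]) * C ((d:ℂ)⁻¹) = 1 := by
      rw [← C_eq_natCast, ← C_mul, mul_inv_cancel₀ hd0, C_1]
    have hqA : q * J1 d q k = (d:ℂ)⁻¹ • derivative f := by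
      rw [← hJ, smul_eq_C_mul]
      linear_combination (-(q * J1 d q k)) * hdd
    refine ⟨?_, ?_, ?_⟩
    · have : q * J1 d q k ∈ degreeLT ℂ (n*d) := by
        rw [hqA]
        apply Submodule.smul_mem
        rw [mem_dLT]
        intro i hi
        rw [coeff_derivative, mem_dLT.mp hf (i+1) (by omega), zero_mul]
      have := dLT_of_mul hq this
      rwa [hs, show n * d - s = e + n by omega] at this
    · have : q * ((n:ℂ) • (q * k) - X * J1 d q k) ∈ degreeLT ℂ (n*d) := by
        have e1 : q * ((n:ℂ) • (q * k) - X * J1 d q k) = (n:ℂ) • f - (d:ℂ)⁻¹ • (X * derivative f) := by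
          have : q * ((n:ℂ) • (q * k) - X * J1 d q k) = (n:ℂ) • f - X * (q * J1 d q k) := by
            rw [hfdef]; simp only [smul_eq_C_mul]; ring
          rw [this, hqA, mul_smul_comm]
        rw [e1, mem_dLT]
        intro i hi
        rw [coeff_sub, coeff_smul, coeff_smul]
        rcases Nat.eq_or_lt_of_le hi with h | h
        · obtain ⟨v, hv⟩ : ∃ v, i = v + 1 := ⟨i - 1, by
            have : 0 < n * d := Nat.mul_pos (by omega) (by omega)
            omega⟩
          have hv' : (v:ℂ) + 1 = n * d := by
            have : v + 1 = n * d := by omega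
            exact_mod_cast this
          rw [hv, coeff_X_mul, coeff_derivative, hv']
          simp only [smul_eq_mul]
          field_simp
          ring
        · obtain ⟨v, hv⟩ : ∃ v, i = v + 1 := ⟨i - 1, by omega⟩
          rw [hv, coeff_X_mul, coeff_derivative, mem_dLT.mp hf (v+1) (by omega)]
          simp
      have := dLT_of_mul hq this
      rwa [hs, show n * d - s = e + n by omega] at this
    · have e1 : q * ((n:ℂ) • (q * k) - X * J1 d q k + X * J1 d q k) = C (n:ℂ) * f := by
        rw [hfdef]; simp only [smul_eq_C_mul]; ring
      rw [e1, derivative_C_mul, ← hJ, C_eq_natCast]; ring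

theorem finrank_RR (n d s e : ℕ) (hn : 1 ≤ n) (hd : 1 ≤ d) (q : ℂ[X]) (hq : q.Monic)
    (hs : q.natDegree = s) (hcop : IsCoprime q (derivative q)) (hes : e + n + s = n * d) :
    Module.finrank ℂ (RR n d (e+n) q) = n*d+1-2*s := by
  rw [RR_eq n d s e hn hd q hq hs hcop hes]
  have hn0 : (n:ℂ) ≠ 0 := by exact_mod_cast (by omega : n ≠ 0)
  have hinj : Function.Injective (JJ n d q) := by
    rw [injective_iff_map_eq_zero]
    intro k hk
    rw [JJ_apply, Prod.mk_eq_zero] at hk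
    obtain ⟨h1, h2⟩ := hk
    rw [h1, mul_zero, sub_zero] at h2
    have := (smul_eq_zero.mp h2).resolve_left hn0
    exact (mul_eq_zero.mp this).resolve_left hq.ne_zero
  rw [← (Submodule.equivMapOfInjective _ hinj (degreeLT ℂ (n*d+1-2*s))).finrank_eq, finrank_dLT]

def mulQ (n e : ℕ) (q : ℂ[X]) : (Fin (n+1) → degreeLT ℂ (e+1)) →ₗ[ℂ] (Fin (n+1) → ℂ[X]) :=
  ((LinearMap.mulLeft ℂ q).compLeft (Fin (n+1))).comp (inc n e)

theorem mulQ_apply (n e : ℕ) (q : ℂ[X]) (h) (j : Fin (n+1)) : mulQ n e q h j = q * h j := rfl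

theorem Fsum_mul (n : ℕ) (q : ℂ[X]) (h : Fin (n+1) → ℂ[X]) :
    Fsum n (fun j => q * h j) = q * Fsum n h := by
  simp only [Fsum_apply, Finset.mul_sum]
  exact Finset.sum_congr rfl fun j _ => by ring

theorem Gsum_mul (n : ℕ) (q : ℂ[X]) (h : Fin (n+1) → ℂ[X]) :
    Gsum n (fun j => q * h j) = q * Gsum n h := by
  simp only [Gsum_apply, Finset.mul_sum]
  exact Finset.sum_congr rfl fun j _ => by ring

theorem cond_iff (n d : ℕ) (hn : 1 ≤ n) (q : ℂ[X]) (h : Fin (n+1) → ℂ[X]) :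
    derivative (q * (Bsum n h + X * Gsum n h)) = ((n:ℂ[X]) * (d:ℂ[X])) * (q * Gsum n h) ↔
    derivative (Fsum n (fun j => q * h j)) = (d:ℂ) • Gsum n (fun j => q * h j) := by
  have hnC : (n:ℂ[X]) ≠ 0 := by exact_mod_cast (by omega : n ≠ 0)
  rw [Fsum_mul, Gsum_mul, Bsum_def]
  have e1 : q * ((n:ℂ) • Fsum n h - X * Gsum n h + X * Gsum n h) = C (n:ℂ) * (q * Fsum n h) := by
    simp only [smul_eq_C_mul]; ring
  rw [e1, derivative_C_mul, smul_eq_C_mul, C_eq_natCast, C_eq_natCast, mul_assoc]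
  exact mul_right_inj' hnC

theorem map_mulQ (n d s e : ℕ) (hn : 1 ≤ n) (he : 1 ≤ e) (q : ℂ[X]) (hq : q.Monic)
    (hs : q.natDegree = s) (hes : e + s = n * (d-1)) :
    ((RR n d (e+n) q).comap (TT n e)).map (mulQ n e q) = Wsub n d ⊓ Vq n q := by
  apply le_antisymm
  · rintro _ ⟨h, hh, rfl⟩
    have hh : TT n e h ∈ RR n d (e+n) q := hh
    rw [TT_apply, mem_RR] at hh
    refine ⟨?_, fun j => ⟨_, mulQ_apply n e q h j⟩⟩
    rw [SetLike.mem_coe, mem_Wsub]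
    refine ⟨fun j => dLT_mul (h j).2 (by omega), ?_⟩
    exact (cond_iff n d hn q (inc n e h)).mp hh.2.2
  · rintro g ⟨hW, hV⟩
    rw [SetLike.mem_coe, mem_Wsub] at hW
    rw [SetLike.mem_coe, mem_Vq] at hV
    choose h hh using hV
    have hm : ∀ j, h j ∈ degreeLT ℂ (e+1) := by
      intro j
      have := hW.1 j
      rw [hh j] at this
      have := dLT_of_mul hq this
      rwa [hs, show n * (d-1) + 1 - s = e + 1 by omega] at this
    have hg : g = fun j => q * h j := funext hh
    refine ⟨fun j => ⟨h j, hm j⟩, ?_, ?_⟩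
    · show TT n e _ ∈ RR n d (e+n) q
      have hr : TT n e (fun j => ⟨h j, hm j⟩) ∈ (degreeLT ℂ (e+n)).prod (degreeLT ℂ (e+n)) := by
        rw [← range_TT n e hn he]; exact LinearMap.mem_range_self _ _
      rw [TT_apply] at hr ⊢
      rw [mem_RR]
      refine ⟨hr.1, hr.2, ?_⟩
      apply (cond_iff n d hn q _).mpr
      rw [hg] at hW
      exact hW.2
    · rw [hg]; rfl

theorem finrank_WV (n d s e : ℕ) (hn : 1 ≤ n) (hd : 1 ≤ d) (he : 1 ≤ e) (q : ℂ[X]) (hq : q.Monic)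
    (hs : q.natDegree = s) (hcop : IsCoprime q (derivative q)) (hes : e + s = n * (d-1)) :
    Module.finrank ℂ (Wsub n d ⊓ Vq n q : Submodule ℂ _) + 2 * (e + n)
      = (n+1) * (e+1) + (n*d+1-2*s) := by
  have hnd : n * d = n * (d-1) + n := by
    obtain ⟨k, rfl⟩ := Nat.exists_eq_add_of_le hd
    rw [Nat.add_sub_cancel_left]; ring
  have hinj : Function.Injective (mulQ n e q) := by
    rw [injective_iff_map_eq_zero]
    intro h hh
    funext j
    have := congrFun hh j
    rw [mulQ_apply] at this
    exact Subtype.ext ((mul_eq_zero.mp this).resolve_left hq.ne_zero)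
  rw [← map_mulQ n d s e hn he q hq hs hes,
    ← (Submodule.equivMapOfInjective _ hinj _).finrank_eq, finrank_comap_eq,
    finrank_RR n d s e hn hd q hq hs hcop (by omega)]
  · have := finrank_ker_TT n e hn he
    omega
  · rw [range_TT n e hn he]
    rintro ⟨A, B⟩ ⟨h1, h2, _⟩
    exact ⟨h1, h2⟩

theorem WV_bot (n d s : ℕ) (q : ℂ[X]) (hq : q.Monic)
    (hs : q.natDegree = s) (hcop : IsCoprime q (derivative q)) (hes : n * (d-1) ≤ s) (hns : n < s) :
    Wsub n d ⊓ Vq n q = ⊥ := by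
  rw [eq_bot_iff]
  rintro g ⟨hW, hV⟩
  rw [SetLike.mem_coe, mem_Wsub] at hW
  rw [SetLike.mem_coe, mem_Vq] at hV
  choose h hh using hV
  have hm : ∀ j, h j = C ((h j).coeff 0) := by
    intro j
    have := hW.1 j
    rw [hh j] at this
    have := dLT_of_mul hq this
    apply eq_C_of_degree_le_zero
    rw [mem_degreeLT] at this
    rw [← Nat.cast_zero, degree_le_iff_coeff_zero]
    intro i hi
    refine mem_dLT.mp (mem_degreeLT.mpr this) i ?_
    have : 0 < i := by exact_mod_cast hi
    omega
  have hg : g = fun j => q * h j := funext hh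
  have h2 := hW.2
  rw [hg, Fsum_mul, Gsum_mul, derivative_mul, smul_eq_C_mul] at h2
  have hdvd : q ∣ Fsum n h := by
    apply hcop.dvd_of_dvd_mul_right
    exact ⟨C (d:ℂ) * Gsum n h - derivative (Fsum n h), by linear_combination h2⟩
  have hF : Fsum n h = 0 := by
    apply eq_zero_of_dvd_of_natDegree_lt hdvd
    rw [hs]
    refine lt_of_le_of_lt ?_ hns
    rw [Fsum_apply]
    apply natDegree_sum_le_of_forall_le
    intro j _
    rw [hm j, mul_comm]
    exact (natDegree_C_mul_X_pow_le _ _).trans (by omega)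
  have : ∀ j, h j = 0 := by
    intro j
    have hc := congrArg (fun P => P.coeff (j:ℕ)) hF
    simp only [Fsum_apply, finsetSum_coeff, coeff_zero] at hc
    rw [Finset.sum_eq_single j] at hc
    · rw [coeff_X_pow_mul', if_pos le_rfl, Nat.sub_self] at hc
      rw [hm j, hc, C_0]
    · intro i _ hij
      rw [hm i, mul_comm, coeff_C_mul_X_pow, if_neg]
      intro hji; exact hij (Fin.ext hji.symm)
    · simp
  rw [Submodule.mem_bot, hg]
  funext j
  simp [this j]

end RNC
namespace RNC

open Polynomial

theorem eval_Phi (n : ℕ) (P : MvPolynomial (Fin (n+1)) ℂ) (j : Fin (n+1)) (u : ℂ) :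
    (Phi n P j).eval u = MvPolynomial.aeval (rncPoint n u) (MvPolynomial.pderiv j P) := by
  rw [Phi_apply, ← Polynomial.coe_aeval_eq_eval, ← AlgHom.comp_apply]
  congr 1
  apply MvPolynomial.algHom_ext
  intro k
  simp [rncPoint]

/-- the vanishing polynomial of the parameters -/
def qpoly (s : ℕ) (tp : Fin s → ℂ) : ℂ[X] := ∏ i, (X - C (tp i))

theorem qpoly_monic (s : ℕ) (tp : Fin s → ℂ) : (qpoly s tp).Monic :=
  monic_prod_X_sub_C _ _

theorem qpoly_natDegree (s : ℕ) (tp : Fin s → ℂ) : (qpoly s tp).natDegree = s := by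
  rw [qpoly, natDegree_finsetProd_X_sub_C_eq_card]; simp

theorem qpoly_coprime (s : ℕ) (tp : Fin s → ℂ) (h : Function.Injective tp) :
    IsCoprime (qpoly s tp) (derivative (qpoly s tp)) :=
  separable_prod_X_sub_C_iff.mpr h

theorem qpoly_dvd (s : ℕ) (tp : Fin s → ℂ) (h : Function.Injective tp) (p : ℂ[X]) :
    qpoly s tp ∣ p ↔ ∀ i, p.eval (tp i) = 0 := by
  constructor
  · intro hd i
    have h1 : (X - C (tp i)) ∣ qpoly s tp :=
      Finset.dvd_prod_of_mem (fun i => X - C (tp i)) (Finset.mem_univ i)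
    exact dvd_iff_isRoot.mp (h1.trans hd)
  · intro hp
    apply Finset.prod_dvd_of_coprime
    · intro i _ j _ hij
      exact pairwise_coprime_X_sub_C h hij
    · intro i _
      exact dvd_iff_isRoot.mpr (hp i)

theorem linSys_eq (n d s : ℕ) (hd : 1 ≤ d) (m : Fin s → ℕ) (hm : ∀ i, m i = 2)
    (tp : Fin s → ℂ) (htp : Function.Injective tp) :
    linSys n d s m tp = MvPolynomial.homogeneousSubmodule (Fin (n+1)) ℂ d ⊓
      (Vq n (qpoly s tp)).comap (Phi n) := by
  ext P
  simp only [linSys, Submodule.mem_inf, Submodule.mem_iInf, LinearMap.mem_ker, Submodule.mem_comap,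
    mem_Vq, qpoly_dvd s tp htp, eval_Phi, hm, LinearMap.comp_apply, AlgHom.toLinearMap_apply]
  refine and_congr_right fun hP => ?_
  constructor
  · intro h j i
    exact h i [j] (by simp)
  · intro h i D hD
    match D with
    | [j] => exact h j i
    | [] =>
      show MvPolynomial.aeval (rncPoint n (tp i)) P = 0
      have hE := congrArg (MvPolynomial.aeval (rncPoint n (tp i)))
        (MvPolynomial.IsHomogeneous.sum_X_mul_pderiv hP)
      rw [map_sum] at hE
      simp only [map_mul, h, mul_zero, Finset.sum_const_zero, map_nsmul] at hE
      have hd0 : (d:ℂ) ≠ 0 := by exact_mod_cast (by omega : d ≠ 0)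
      rw [nsmul_eq_mul] at hE
      exact (mul_eq_zero.mp hE.symm).resolve_left hd0
    | _ :: _ :: _ => simp at hD

theorem hom_inj (n r : ℕ) (hr : r ≤ 1) (Q : MvPolynomial (Fin (n+1)) ℂ) (hQ : Q.IsHomogeneous r)
    (h : MvPolynomial.aeval (fun k : Fin (n+1) => (X : ℂ[X]) ^ (k:ℕ)) Q = 0) : Q = 0 := by
  rcases Nat.le_one_iff_eq_zero_or_eq_one.mp hr with rfl | rfl
  · have hQ' : Q ∈ MvPolynomial.homogeneousSubmodule (Fin (n+1)) ℂ 0 := hQ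
    rw [MvPolynomial.homogeneousSubmodule_zero, Submodule.mem_one] at hQ'
    obtain ⟨c, rfl⟩ := hQ'
    rw [AlgHom.commutes] at h
    have : c = 0 := by simpa using h
    simp [this]
  · have hQ' : Q ∈ MvPolynomial.homogeneousSubmodule (Fin (n+1)) ℂ 1 := hQ
    rw [MvPolynomial.homogeneousSubmodule_one_eq_span_X, Submodule.mem_span_range_iff_exists_fun] at hQ'
    obtain ⟨c, rfl⟩ := hQ'
    have hc : ∀ k, c k = 0 := by
      intro k
      have := congrArg (fun p => p.coeff (k:ℕ)) h
      simp only [map_sum, map_smul, MvPolynomial.aeval_X, finsetSum_coeff, coeff_smul, coeff_X_pow,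
        coeff_zero, smul_eq_mul, mul_ite, mul_one, mul_zero, Fin.val_inj, Finset.sum_ite_eq,
        Finset.mem_univ, if_true] at this
      exact this
    simp [hc]

theorem linSys_small (n d s : ℕ) (hn : 2 ≤ n) (hs : n + 3 ≤ s) (hd : d ≤ 2)
    (m : Fin s → ℕ) (hm : ∀ i, m i = 2) (tp : Fin s → ℂ) (htp : Function.Injective tp) :
    linSys n d s m tp = ⊥ := by
  rw [eq_bot_iff]
  intro P hP
  rw [Submodule.mem_bot]
  rcases Nat.eq_zero_or_pos d with rfl | hd1
  · have h1 : P ∈ MvPolynomial.homogeneousSubmodule (Fin (n+1)) ℂ 0 := hP.1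
    have h2 := hP.2
    simp only [SetLike.mem_coe, Submodule.mem_iInf, LinearMap.mem_ker] at h2
    have h3 : MvPolynomial.aeval (rncPoint n (tp ⟨0, by omega⟩)) P = 0 :=
      h2 ⟨0, by omega⟩ [] (by simp [hm])
    rw [MvPolynomial.homogeneousSubmodule_zero, Submodule.mem_one] at h1
    obtain ⟨c, rfl⟩ := h1
    rw [AlgHom.commutes] at h3
    have : c = 0 := h3
    simp [this]
  · rw [linSys_eq n d s hd1 m hm tp htp] at hP
    have hP1 : P.IsHomogeneous d := hP.1
    have hW := Phi_map_le n d (Submodule.mem_map_of_mem hP.1)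
    rw [mem_Wsub] at hW
    have hV : ∀ j, qpoly s tp ∣ Phi n P j := hP.2
    have hz : ∀ j, Phi n P j = 0 := by
      intro j
      by_contra hne
      have h1 := natDegree_le_of_dvd (hV j) hne
      rw [qpoly_natDegree] at h1
      have h2 := hW.1 j
      rw [mem_degreeLT, ← natDegree_lt_iff_degree_lt hne] at h2
      have : n * (d-1) ≤ n * 1 := Nat.mul_le_mul_left _ (by omega)
      omega
    have hp : ∀ j, MvPolynomial.pderiv j P = 0 := by
      intro j
      exact hom_inj n (d-1) (by omega) _ hP1.pderiv (hz j)
    have hE := MvPolynomial.IsHomogeneous.sum_X_mul_pderiv hP1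
    simp only [hp, mul_zero, Finset.sum_const_zero] at hE
    exact (smul_eq_zero.mp hE.symm).resolve_left (by omega)

theorem finrank_linSys (n d s : ℕ) (hn : 2 ≤ n) (hd : 3 ≤ d)
    (m : Fin s → ℕ) (hm : ∀ i, m i = 2) (tp : Fin s → ℂ) (htp : Function.Injective tp) :
    Module.finrank ℂ (linSys n d s m tp) + Module.finrank ℂ (Wsub n d) = (n + d).choose n +
      Module.finrank ℂ (Wsub n d ⊓ Vq n (qpoly s tp) : Submodule ℂ _) := by
  set S := MvPolynomial.homogeneousSubmodule (Fin (n+1)) ℂ d with hS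
  have : FiniteDimensional ℂ S :=
    Module.Finite.iff_fg.mpr (MvPolynomial.homogeneousSubmodule_fg _ _ d)
  set f := (Phi n).domRestrict S with hf
  have hr : LinearMap.range f = Wsub n d := by
    rw [hf, LinearMap.range_domRestrict, Phi_map_eq n d (by omega) hd]
  have h1 := LinearMap.finrank_range_add_finrank_ker f
  rw [hr, finrank_hom] at h1
  have h2 := finrank_comap_eq f (Wsub n d ⊓ Vq n (qpoly s tp)) (by rw [hr]; exact inf_le_left)
  have h3 : Module.finrank ℂ (linSys n d s m tp)
      = Module.finrank ℂ ((Wsub n d ⊓ Vq n (qpoly s tp)).comap f) := by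
    have hle : linSys n d s m tp ≤ S := inf_le_left
    rw [← (Submodule.comapSubtypeEquivOfLe hle).finrank_eq]
    have : (linSys n d s m tp).comap S.subtype = (Wsub n d ⊓ Vq n (qpoly s tp)).comap f := by
      ext ⟨P, hP⟩
      rw [linSys_eq n d s (by omega) m hm tp htp]
      have hW : Phi n P ∈ Wsub n d := Phi_map_le n d (Submodule.mem_map_of_mem hP)
      constructor
      · intro h; exact ⟨hW, h.2⟩
      · intro h; exact ⟨hP, h.2⟩
    rw [this]
  omega

theorem finrank_W (n d : ℕ) (hn : 2 ≤ n) (hd : 3 ≤ d) :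
    Module.finrank ℂ (Wsub n d) + 2 * (n * (d-1) + n) = (n+1) * (n*(d-1)+1) + (n*d+1) := by
  have he : 1 ≤ n * (d-1) := Nat.mul_pos (by omega) (by omega)
  have := finrank_WV n d 0 (n*(d-1)) (by omega) (by omega) he 1 monic_one natDegree_one
    isCoprime_one_left rfl
  have hV : Wsub n d ⊓ Vq n 1 = Wsub n d := by
    rw [inf_eq_left]
    intro g _ j
    exact one_dvd _
  rw [hV] at this
  simpa using this

end RNC

/-- **Double points (Corollary 2.7, answering Hà–Mantero).** Let `m_1 = ⋯ = m_s = 2`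
with `s ≥ n+3` points on a rational normal curve, and suppose `L = L_{n,d}(2,…,2)` is
effective. With `vdim = C(n+d,n) − s(n+1)`:
(i) if `nd ≥ 2s−1` then `dim L = max(vdim,0)`;
(ii) if `s+n+2 ≤ nd ≤ 2s−2` then `dim L = vdim + (2s − nd − 1)`;
(iii) if `nd ≤ s+n+1` then `dim L = vdim + s(n+1) − n²(d−1) − 2`. -/
theorem stmt_7 (n d s : ℕ) (hn : 2 ≤ n) (hs : n + 3 ≤ s)
    (m : Fin s → ℕ) (hm : ∀ i, m i = 2)
    (tp : Fin s → ℂ) (htp : Function.Injective tp)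
    (heff : linSys n d s m tp ≠ ⊥) :
    ((2 * (s : ℤ) - 1 ≤ (n : ℤ) * d →
        (Module.finrank ℂ (linSys n d s m tp) : ℤ) =
          max (Cb ((n : ℤ) + d) n - (s : ℤ) * ((n : ℤ) + 1)) 0) ∧
      ((s : ℤ) + n + 2 ≤ (n : ℤ) * d ∧ (n : ℤ) * d ≤ 2 * (s : ℤ) - 2 →
        (Module.finrank ℂ (linSys n d s m tp) : ℤ) =
          (Cb ((n : ℤ) + d) n - (s : ℤ) * ((n : ℤ) + 1))
            + (2 * (s : ℤ) - (n : ℤ) * d - 1)) ∧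
      ((n : ℤ) * d ≤ (s : ℤ) + n + 1 →
        (Module.finrank ℂ (linSys n d s m tp) : ℤ) =
          (Cb ((n : ℤ) + d) n - (s : ℤ) * ((n : ℤ) + 1))
            + ((s : ℤ) * ((n : ℤ) + 1) - (n : ℤ)^2 * ((d : ℤ) - 1) - 2))) := by
  have hd : 3 ≤ d := by
    by_contra h
    exact heff (RNC.linSys_small n d s hn hs (by omega) m hm tp htp)
  have h1 := RNC.finrank_linSys n d s hn hd m hm tp htp
  have h2 := RNC.finrank_W n d hn hd
  have hq1 := RNC.qpoly_monic s tp
  have hq2 := RNC.qpoly_natDegree s tp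
  have hq3 := RNC.qpoly_coprime s tp htp
  have hCb : Cb ((n : ℤ) + d) n = ((n + d).choose n : ℤ) := by
    have e1 : ((n : ℤ) + d).toNat = n + d := by omega
    rw [Cb, if_pos (by omega), e1, Int.toNat_natCast]
  rw [hCb]
  have hnd : n * d = n * (d-1) + n := by
    obtain ⟨k, rfl⟩ := Nat.exists_eq_add_of_le hd
    have h1 : 3 + k - 1 = k + 2 := by omega
    rw [h1]; ring
  have hndZ : (n:ℤ) * d = ((n * (d-1) : ℕ) : ℤ) + n := by exact_mod_cast hnd
  have hn2 : (n:ℤ)^2 * ((d:ℤ) - 1) = n * ((n * (d-1) : ℕ) : ℤ) := by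
    have : ((n * (d-1) : ℕ) : ℤ) = n * d - n := by omega
    rw [this]; ring
  rw [hn2, hndZ]
  rw [hnd] at h2
  generalize hE : n * (d-1) = E at *
  generalize Module.finrank ℂ (linSys n d s m tp) = L at *
  generalize (n + d).choose n = c at *
  generalize Module.finrank ℂ (RNC.Wsub n d) = w at *
  by_cases he : E ≤ s
  · have h3 := RNC.WV_bot n d s _ hq1 hq2 hq3 (by omega) (by omega)
    rw [h3, finrank_bot] at h1
    zify at h1 h2
    refine ⟨fun h => ?_, fun h => ?_, fun h => ?_⟩
    · exfalso; omega
    · exfalso; omega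
    · linear_combination h1 - h2
  · obtain ⟨e, rfl⟩ := Nat.exists_eq_add_of_le (le_of_not_ge he)
    have h3 := RNC.finrank_WV n d s e (by omega) (by omega) (by omega) _ hq1 hq2 hq3 (by omega)
    generalize Module.finrank ℂ (RNC.Wsub n d ⊓ RNC.Vq n (RNC.qpoly s tp) : Submodule ℂ _) = v at *
    rw [hnd] at h3
    have big : 2 * (s : ℤ) - 1 ≤ ((s + e : ℕ) : ℤ) + n →
        (L : ℤ) = (c : ℤ) - (s : ℤ) * ((n : ℤ) + 1) := by
      intro h
      obtain ⟨r, hr⟩ : ∃ r, r = s + e + n + 1 - 2 * s := ⟨_, rfl⟩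
      rw [← hr] at h3
      have hr' : (r : ℤ) = s + e + n + 1 - 2 * s := by omega
      zify at h1 h2 h3
      push_cast at *
      linear_combination h1 - h2 + h3 + hr'
    have small : ((s + e : ℕ) : ℤ) + n ≤ 2 * (s : ℤ) - 2 →
        (L : ℤ) + (s + e + n) * (n - 1 : ℤ) = (c : ℤ) + (n - 1) * (e - 1)
          + (s + e + n) * (n - 1 : ℤ) - (n * (s + e) + 2) := by
      intro h
      have hr : s + e + n + 1 - 2 * s = 0 := by omega
      rw [hr] at h3
      zify at h1 h2 h3
      linear_combination h1 - h2 + h3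
    refine ⟨fun h => ?_, fun h => ?_, fun h => ?_⟩
    · have := big h
      rw [← this, max_eq_left (by omega)]
    · have := small h.2
      push_cast
      linear_combination this
    · have := small (by omega)
      have he1 : e = 1 := by omega
      subst he1
      push_cast at *
      linear_combination this

end
end
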